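/- arXiv:1605.07845 — 3 statements merged into one kernel-verified Lean document; each statement's English description precedes it below -/
import Mathlib

section
/- Let K be a compact connected non-empty subset of a metric space (M, d). Then there exists a sequence {α_1, α_2, …} of points of K such that the closure of {α_j : j ∈ ℕ, j > n} equals K for every n ∈ ℕ, and lim_{j→∞} d(α_j, α_{j+1}) = 0. -/
open MeasureTheory Filter Topology Set
open scoped ENNReal Classical

namespace Paper

variable {A : Type} [Fintype A] [DecidableEq A] [TopologicalSpace A] [DiscreteTopology A]
  [MeasurableSpace A] [BorelSpace A]

/-- The left shift map on the full shift `A^ℕ`. -/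
def shift : (ℕ → A) → (ℕ → A) := fun x i => x (i + 1)

/-- The cylinder set of a finite word `w`: points whose initial word is `w`. -/
def cylinder (w : List A) : Set (ℕ → A) := {x | ∀ i : Fin w.length, x i = w.get i}

/-- The language of `X`: finite words `w` with `[w] ∩ X ≠ ∅`. -/
def language (X : Set (ℕ → A)) : Set (List A) := {w | (cylinder w ∩ X).Nonempty}

/-- One edit of a word: a substitution, an insertion, or a deletion. -/
def EditStep (w w' : List A) : Prop :=
  (∃ u₁ u₂ : List A, ∃ a a' : A, w = u₁ ++ [a] ++ u₂ ∧ w' = u₁ ++ [a'] ++ u₂) ∨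
  (∃ u₁ u₂ : List A, ∃ a' : A, w = u₁ ++ u₂ ∧ w' = u₁ ++ [a'] ++ u₂) ∨
  (∃ u₁ u₂ : List A, ∃ a : A, w = u₁ ++ [a] ++ u₂ ∧ w' = u₁ ++ u₂)

/-- The edit distance: the minimal number of edits transforming `v` into `w`. -/
noncomputable def editDist (v w : List A) : ℕ :=
  sInf {n | ∃ f : ℕ → List A, f 0 = v ∧ f n = w ∧ ∀ i < n, EditStep (f i) (f (i + 1))}

/-- `G ⊆ L` has (W)-specification (with some gap length `τ`). -/
def HasSpecW (L G : Set (List A)) : Prop :=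
  ∃ τ : ℕ, ∀ v ∈ G, ∀ w ∈ G, ∃ u ∈ L, u.length ≤ τ ∧ v ++ u ++ w ∈ G

/-- A mistake function: nondecreasing with `g n / n → 0`. -/
def MistakeFun (g : ℕ → ℕ) : Prop :=
  Monotone g ∧ Tendsto (fun n => (g n : ℝ) / n) atTop (𝓝 0)

/-- `L` is edit approachable by `G`. -/
def EditApproachable (L G : Set (List A)) : Prop :=
  ∃ g : ℕ → ℕ, MistakeFun g ∧ ∀ w ∈ L, ∃ v ∈ G, editDist v w ≤ g w.length

/-- The shift map restricted to a (shift-invariant) subset `X`, as a self-map of `↥X`. -/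
noncomputable def subShift (X : Set (ℕ → A)) : ↥X → ↥X := fun x =>
  if h : shift x.val ∈ X then ⟨shift x.val, h⟩ else x

/-- Birkhoff sum `S_n φ = ∑_{i<n} φ ∘ σ^i`. -/
def birkhoff {Y : Type*} (σ : Y → Y) (φ : Y → ℝ) (n : ℕ) (y : Y) : ℝ :=
  ∑ i ∈ Finset.range n, φ (σ^[i] y)

/-- The Birkhoff average `(1/n) S_n φ`. -/
noncomputable def birkAvg {Y : Type*} (σ : Y → Y) (φ : Y → ℝ) (n : ℕ) (y : Y) : ℝ :=
  (n : ℝ)⁻¹ * birkhoff σ φ n y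

/-- Carathéodory sum `M(Z,t,φ,N)` over covers of `Z` by cylinders of length `> N`. -/
noncomputable def Mcal (X : Set (ℕ → A)) (φ : ↥X → ℝ) (Z : Set ↥X) (t : ℝ) (N : ℕ) : ℝ≥0∞ :=
  ⨅ (S : Set (List A)) (_ : S.Countable) (_ : ∀ w ∈ S, N < w.length)
    (_ : Z ⊆ ⋃ w ∈ S, Subtype.val ⁻¹' cylinder w),
    ∑' w : S, ENNReal.ofReal (Real.exp (-t * (w : List A).length +
      sSup (birkhoff (subShift X) φ (w : List A).length ''
        (Subtype.val ⁻¹' cylinder (w : List A)))))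

/-- `M(Z,t,φ) = lim_{N→∞} M(Z,t,φ,N)` (the limit of a nondecreasing quantity). -/
noncomputable def McalLim (X : Set (ℕ → A)) (φ : ↥X → ℝ) (Z : Set ↥X) (t : ℝ) : ℝ≥0∞ :=
  ⨆ N : ℕ, Mcal X φ Z t N

/-- The topological pressure `P_Z(φ)` of `Z ⊆ X`. -/
noncomputable def pressure (X : Set (ℕ → A)) (φ : ↥X → ℝ) (Z : Set ↥X) : ℝ :=
  sInf {t : ℝ | McalLim X φ Z t = 0}

/-- The empirical measure `ℰ_n(x) = (1/n) ∑_{i<n} δ_{σ^i x}`. -/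
noncomputable def empiric {Y : Type*} [MeasurableSpace Y] (σ : Y → Y) (n : ℕ) (x : Y) :
    Measure Y := (n : ℝ≥0∞)⁻¹ • ∑ i ∈ Finset.range n, Measure.dirac (σ^[i] x)

/-- The set `A(ℰ_n(x))` of weak* limit points of the sequence of empirical measures of `x`:
probability measures that are limits of the empirical measures along a subsequence. -/
def limitPts {Y : Type*} [MeasurableSpace Y] [TopologicalSpace Y] (σ : Y → Y) (x : Y) :
    Set (ProbabilityMeasure Y) :=
  {μ | ∃ φ : ℕ → ℕ, StrictMono φ ∧ ∀ f : C(Y, ℝ),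
      Tendsto (fun k => birkAvg σ (fun y => f y) (φ k) x) atTop (𝓝 (∫ y, f y ∂μ.toMeasure))}

/-- The saturated set `G_K = {x : A(ℰ_n(x)) = K}`. -/
def saturated {Y : Type*} [MeasurableSpace Y] [TopologicalSpace Y] (σ : Y → Y)
    (K : Set (ProbabilityMeasure Y)) : Set Y := {x | limitPts σ x = K}

/-- The generic points of `μ`: those `x` with `ℰ_n(x) → μ` in the weak* topology. -/
def genericPts {Y : Type*} [MeasurableSpace Y] [TopologicalSpace Y] (σ : Y → Y)
    (μ : ProbabilityMeasure Y) : Set Y :=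
  {x | ∀ f : C(Y, ℝ),
      Tendsto (fun n => birkAvg σ (fun y => f y) n x) atTop (𝓝 (∫ y, f y ∂μ.toMeasure))}

/-- `μ` is a `σ`-invariant (probability) measure. -/
def IsInvariant {Y : Type*} [MeasurableSpace Y] (σ : Y → Y) (μ : ProbabilityMeasure Y) : Prop :=
  μ.toMeasure.map σ = μ.toMeasure

/-- The level set `X(ψ,α)` of points whose Birkhoff averages of `ψ` converge to `α`. -/
def levelSet {Y : Type*} (σ : Y → Y) (ψ : Y → ℝ) (α : ℝ) : Set Y :=
  {x | Tendsto (fun n => birkAvg σ ψ n x) atTop (𝓝 α)}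

/-- The irregular set `X̂(ψ)` of points whose Birkhoff averages of `ψ` do not converge. -/
def irregular {Y : Type*} (σ : Y → Y) (ψ : Y → ℝ) : Set Y :=
  {x | ¬ ∃ α : ℝ, Tendsto (fun n => birkAvg σ ψ n x) atTop (𝓝 α)}

/-- The cylinder of a word of length `n` given as `w : Fin n → A`. -/
def cylF {n : ℕ} (w : Fin n → A) : Set (ℕ → A) := {x | ∀ i : Fin n, x i = w i}

/-- The entropy `H_n(μ)` of the partition of `X` into cylinders of length `n`. -/
noncomputable def wordEntropy (X : Set (ℕ → A)) (μ : ProbabilityMeasure ↥X) (n : ℕ) : ℝ :=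
  ∑ w : Fin n → A, Real.negMulLog ((μ.toMeasure (Subtype.val ⁻¹' cylF w)).toReal)

/-- The measure-theoretic (Kolmogorov–Sinai) entropy `h_μ(σ)` of a shift-invariant measure on a
subshift: by subadditivity, `lim_n H_n/n = inf_{n ≥ 1} H_n/n`. -/
noncomputable def entropy (X : Set (ℕ → A)) (μ : ProbabilityMeasure ↥X) : ℝ :=
  ⨅ n : ℕ, wordEntropy X μ (n + 1) / (n + 1)

/-- The distance `D` on measures induced by a countable family of continuous functions. -/
noncomputable def Dmetric {Y : Type*} [MeasurableSpace Y] [TopologicalSpace Y]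
    (f : ℕ → C(Y, ℝ)) (μ ν : Measure Y) : ℝ :=
  ∑' k : ℕ, ((2 : ℝ) ^ (k + 1))⁻¹ * |(∫ y, f k y ∂μ) - ∫ y, f k y ∂ν|

/-- The family `f` is separating: `D` separates Borel probability measures. -/
def Separating {Y : Type*} [MeasurableSpace Y] [TopologicalSpace Y] (f : ℕ → C(Y, ℝ)) : Prop :=
  ∀ μ ν : ProbabilityMeasure Y,
    (∀ k, (∫ y, f k y ∂μ.toMeasure) = ∫ y, f k y ∂ν.toMeasure) → μ = ν

/-- Diameter of a set with respect to a distance function `d`, valued in `ℝ≥0∞`. -/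
noncomputable def ediam {Y : Type*} (d : Y → Y → ℝ) (U : Set Y) : ℝ≥0∞ :=
  ⨆ x ∈ U, ⨆ y ∈ U, ENNReal.ofReal (d x y)

/-- The `s`-dimensional Hausdorff pre-measure at scale `ε` w.r.t. the distance `d`. -/
noncomputable def hMeasAux {Y : Type*} (d : Y → Y → ℝ) (s : ℝ) (ε : ℝ≥0∞) (Z : Set Y) : ℝ≥0∞ :=
  ⨅ (C : ℕ → Set Y) (_ : Z ⊆ ⋃ n, C n) (_ : ∀ n, ediam d (C n) ≤ ε),
    ∑' n, ⨆ (_ : (C n).Nonempty), ediam d (C n) ^ s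

/-- The `s`-dimensional Hausdorff measure w.r.t. the distance `d`. -/
noncomputable def hMeas {Y : Type*} (d : Y → Y → ℝ) (s : ℝ) (Z : Set Y) : ℝ≥0∞ :=
  ⨆ (ε : ℝ≥0∞) (_ : 0 < ε), hMeasAux d s ε Z

/-- The Hausdorff dimension of `Z` w.r.t. the distance `d`. -/
noncomputable def hdim {Y : Type*} (d : Y → Y → ℝ) (Z : Set Y) : ℝ :=
  sInf {s : ℝ | 0 ≤ s ∧ hMeas d s Z = 0}

/-- The length `|x ∧ y|` of the longest common prefix of two distinct points. -/
noncomputable def wedge (x y : ℕ → A) : ℕ := sInf {n | x n ≠ y n}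

/-- The Gatzouras–Peres distance `d_φ` associated with a strictly positive continuous `φ`. -/
noncomputable def dphi (X : Set (ℕ → A)) (φ : ↥X → ℝ) (x y : ↥X) : ℝ :=
  if x = y then 0
  else Real.exp (-(sSup (birkhoff (subShift X) φ (wedge x.val y.val) ''
      {z : ↥X | ∀ i < wedge x.val y.val, z.val i = x.val i})))

/-- The word `w` occurs in `x` at position `k`. -/
def occursAt (w : List A) (x : ℕ → A) (k : ℕ) : Prop :=
  ∀ i : Fin w.length, x (k + i) = w.get i

/-- A shift of finite type: determined by a finite set of forbidden words. -/
def IsSFT {B : Type} (Z : Set (ℕ → B)) : Prop :=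
  ∃ F : Set (List B), F.Finite ∧ Z = {x | ∀ w ∈ F, ∀ k, ¬ occursAt w x k}

/-- A sofic shift: the image of a shift of finite type under a sliding block code. -/
def IsSofic (Y : Set (ℕ → A)) : Prop :=
  ∃ (B : Type) (_ : Fintype B) (Z : Set (ℕ → B)) (π : (ℕ → B) → (ℕ → A)),
    IsSFT Z ∧ Set.MapsTo shift Z Z ∧
    (∃ r : ℕ, ∀ z ∈ Z, ∀ z' ∈ Z, ∀ k, (∀ i ≤ k + r, z i = z' i) → π z k = π z' k) ∧
    (∀ z ∈ Z, π (shift z) = shift (π z)) ∧ π '' Z = Y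

/-- Topological transitivity of a subshift, via its language. -/
def IsTransitive (Y : Set (ℕ → A)) : Prop :=
  ∀ u ∈ language Y, ∀ v ∈ language Y, ∃ w : List A, u ++ w ++ v ∈ language Y

/-- The prefix of length `n` of `x`, as a word. -/
def prefixWord (x : ℕ → A) (n : ℕ) : List A := List.ofFn fun i : Fin n => x i

/-- The norm `‖m‖ = sup_{0 < ‖f‖ ≤ 1} |∫ f dm| / ‖f‖` of a measure on a compact space. -/
noncomputable def mnorm {Y : Type*} [TopologicalSpace Y] [CompactSpace Y] [MeasurableSpace Y]
    (m : Measure Y) : ℝ :=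
  sSup ((fun f : C(Y, ℝ) => |∫ y, f y ∂m| / ‖f‖) '' {f : C(Y, ℝ) | 0 < ‖f‖ ∧ ‖f‖ ≤ 1})

/-- Strict lexicographic order on `ℕ`-indexed sequences of naturals. -/
def lexLt (x y : ℕ → ℕ) : Prop := ∃ n : ℕ, (∀ i < n, x i = y i) ∧ x n < y n

/-- The β-shift: all sequences over `{0, …, b-1}` all of whose shifts are lexicographically
below the expansion `w` of `1` in base `β` (where `b = ⌈β⌉`). -/
def betaShift (b : ℕ) (w : ℕ → ℕ) : Set (ℕ → Fin b) :=
  {x | ∀ j : ℕ, 1 ≤ j → lexLt (fun i => ((shift^[j] x) i : ℕ)) w}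

/-- The S-gap shift: sequences over `{0,1}` such that the number of `0`s between any two
consecutive `1`s lies in `S`. -/
def sGapShift (S : Set ℕ) : Set (ℕ → Fin 2) :=
  {x | ∀ k l : ℕ, k < l → x k = 1 → x l = 1 →
    (∀ m : ℕ, k < m → m < l → x m = 0) → l - k - 1 ∈ S}


/-- In a preconnected space, any two points are joined by a finite chain with small steps. -/
theorem exists_dist_chain {X : Type*} [PseudoMetricSpace X] [PreconnectedSpace X] {ε : ℝ}
    (hε : 0 < ε) (x y : X) :
    ∃ (l : ℕ) (γ : ℕ → X), γ 0 = x ∧ γ l = y ∧ ∀ i < l, dist (γ i) (γ (i + 1)) < ε := by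
  have h : Relation.ReflTransGen (fun a b : X => dist a b < ε) x y := by
    refine PreconnectedSpace.induction₂' _ (fun a => ?_) ⟨fun _ _ _ => .trans⟩ x y
    filter_upwards [Metric.ball_mem_nhds a hε] with b hb
    exact ⟨.single (by rwa [dist_comm]), .single hb⟩
  induction h using Relation.ReflTransGen.head_induction_on with
  | refl => exact ⟨0, fun _ => y, rfl, rfl, by simp⟩
  | @head a b hab _ ih =>
    obtain ⟨l, γ, h0, hl, hγ⟩ := ih
    refine ⟨l + 1, fun i => Nat.casesOn i a γ, rfl, hl, fun i hi => ?_⟩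
    cases i with
    | zero => simpa [h0] using hab
    | succ i => exact hγ i (by omega)

/-- In a preconnected space, there is a sequence with asymptotically vanishing steps which passes
through the terms of any prescribed sequence. -/
theorem exists_seq_visiting_tendsto_dist {X : Type*} [PseudoMetricSpace X] [PreconnectedSpace X]
    (t : ℕ → X) :
    ∃ α : ℕ → X, (∀ n, ∃ k ≥ n, α k = t n) ∧
      Tendsto (fun k => dist (α k) (α (k + 1))) atTop (𝓝 0) := by
  choose l γ h0 hl hγ using fun n : ℕ =>
    exists_dist_chain (Nat.one_div_pos_of_nat (α := ℝ) (n := n)) (t n) (t (n + 1))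
  let next : ℕ × ℕ → ℕ × ℕ := fun p => if p.2 < l p.1 then (p.1, p.2 + 1) else (p.1 + 1, 0)
  let s : ℕ → ℕ × ℕ := fun k => next^[k] (0, 0)
  have s_succ (k) : s (k + 1) = next (s k) := Function.iterate_succ_apply' _ _ _
  have s_le (k) : (s k).1 ≤ k := by
    induction k with
    | zero => simp [s]
    | succ k ih => rw [s_succ]; dsimp only [next]; split_ifs <;> dsimp only <;> omega
  have s_mono : Monotone fun k => (s k).1 :=
    monotone_nat_of_le_succ fun k => by
      rw [s_succ]; dsimp only [next]; split_ifs <;> dsimp only <;> omega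
  have s_snd (k) : (s k).2 ≤ l (s k).1 := by
    induction k with
    | zero => simp [s]
    | succ k ih => rw [s_succ]; dsimp only [next]; split_ifs <;> dsimp only <;> omega
  have s_visit (n) : ∃ k, s k = (n, 0) := by
    induction n with
    | zero => exact ⟨0, rfl⟩
    | succ n ih =>
      obtain ⟨k, hk⟩ := ih
      have hi : ∀ i ≤ l n, s (k + i) = (n, i) := by
        intro i
        induction i with
        | zero => intro _; exact hk
        | succ i ih => intro hi; rw [← add_assoc, s_succ, ih (by omega)]; exact if_pos hi
      exact ⟨k + l n + 1, by rw [s_succ, hi _ le_rfl]; simp [next]⟩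
  have s_tendsto : Tendsto (fun k => (s k).1) atTop atTop :=
    tendsto_atTop_atTop_of_monotone s_mono fun n => by
      obtain ⟨k, hk⟩ := s_visit n
      exact ⟨k, by simp [hk]⟩
  refine ⟨fun k => γ (s k).1 (s k).2, fun n => ?_, ?_⟩
  · obtain ⟨k, hk⟩ := s_visit n
    exact ⟨k, by simpa [hk] using s_le k, by simp [hk, h0]⟩
  · refine squeeze_zero (fun _ => dist_nonneg) (fun k => ?_)
      ((tendsto_one_div_add_atTop_nhds_zero_nat (𝕜 := ℝ)).comp s_tendsto)
    simp only [s_succ, Function.comp_apply]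
    by_cases h : (s k).2 < l (s k).1
    · simpa [next, h] using (hγ _ _ h).le
    · have h_eq : (s k).2 = l (s k).1 := le_antisymm (s_snd k) (not_lt.1 h)
      simp only [next, if_neg h, h_eq, hl, h0, dist_self]
      exact Nat.one_div_pos_of_nat.le

/-- a compact connected non-empty set admits a dense sequence with
asymptotically vanishing consecutive distances. -/
theorem statement_8 {M : Type} [MetricSpace M] (K : Set M)
    (hKcpt : IsCompact K) (hKconn : IsConnected K) :
    ∃ α : ℕ → M, (∀ j, α j ∈ K) ∧
      (∀ n : ℕ, closure {x : M | ∃ j : ℕ, n < j ∧ x = α j} = K) ∧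
      Tendsto (fun j => dist (α j) (α (j + 1))) atTop (𝓝 0) := by
  have : CompactSpace K := isCompact_iff_compactSpace.1 hKcpt
  have : ConnectedSpace K := Subtype.connectedSpace hKconn
  obtain ⟨α, hα, hdist⟩ := exists_seq_visiting_tendsto_dist
    fun n => TopologicalSpace.denseSeq K n.unpair.1
  refine ⟨fun j => α j, fun j => (α j).2, fun n => Subset.antisymm ?_ fun x hx => ?_, hdist⟩
  · refine closure_minimal ?_ hKcpt.isClosed
    rintro _ ⟨j, -, rfl⟩
    exact (α j).2
  · refine Metric.mem_closure_iff.2 fun ε hε => ?_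
    obtain ⟨m, hm⟩ := (TopologicalSpace.denseRange_denseSeq K).exists_dist_lt ⟨x, hx⟩ hε
    obtain ⟨k, hk, h_eq⟩ := hα (Nat.pair m (n + 1))
    refine ⟨α k, ⟨k, (Nat.right_le_pair m (n + 1)).trans hk, rfl⟩, ?_⟩
    rw [h_eq]
    simpa [Subtype.dist_eq] using hm

end Paper
end

section
/- Let X be a shift space over a finite alphabet with left shift σ. For any ergodic σ-invariant Borel probability measure μ on X and any ε > 0 and δ > 0, there exists N(μ,ε,δ) ∈ ℕ such that for all n ≥ N(μ,ε,δ), the cardinality of 𝓛_n^{μ,ε} := {w ∈ 𝓛_n(X) : D(ℰ_n(x), μ) < ε for all x ∈ [w]} is at least e^{n(h_μ(σ) − δ)}. -/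
open MeasureTheory Filter Topology Set
open scoped ENNReal Classical

namespace Paper

variable {A : Type} [Fintype A] [DecidableEq A] [TopologicalSpace A] [DiscreteTopology A]
  [MeasurableSpace A] [BorelSpace A]

section Ergodic

variable {Y : Type*} [MeasurableSpace Y]

theorem birkhoffAverage_compMeasurePreserving_ae_eq {σ : Y → Y} {μ : Measure Y}
    (hσ : MeasurePreserving σ μ μ) {φ : Y → ℝ} (hφ : MemLp φ 2 μ) (n : ℕ) :
    (birkhoffAverage ℝ (Lp.compMeasurePreserving (E := ℝ) (p := 2) σ hσ) _root_.id n
      (hφ.toLp φ) : Lp ℝ 2 μ) =ᵐ[μ] birkAvg σ φ n := by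
  have hsum : ∀ n : ℕ, ((∑ i ∈ Finset.range n,
      (Lp.compMeasurePreserving (E := ℝ) (p := 2) σ hσ)^[i] (hφ.toLp φ) : Lp ℝ 2 μ) : Y → ℝ)
        =ᵐ[μ] birkhoff σ φ n := by
    intro n
    induction n with
    | zero =>
      simp only [Finset.range_zero, Finset.sum_empty]
      filter_upwards [Lp.coeFn_zero ℝ 2 μ] with x hx
      exact hx.trans (by simp [birkhoff])
    | succ n ih =>
      rw [Finset.sum_range_succ]
      have h2 : ((Lp.compMeasurePreserving (E := ℝ) (p := 2) σ hσ)^[n] (hφ.toLp φ) : Y → ℝ)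
          =ᵐ[μ] φ ∘ σ^[n] := by
        rw [Lp.compMeasurePreserving_iterate hσ n, Lp.toLp_compMeasurePreserving]
        exact MemLp.coeFn_toLp _
      filter_upwards [Lp.coeFn_add (∑ i ∈ Finset.range n,
        (Lp.compMeasurePreserving (E := ℝ) (p := 2) σ hσ)^[i] (hφ.toLp φ))
        ((Lp.compMeasurePreserving (E := ℝ) (p := 2) σ hσ)^[n] (hφ.toLp φ)), ih, h2]
        with x h1 h2 h3
      rw [h1, Pi.add_apply, h2, h3]
      simp [birkhoff, Finset.sum_range_succ]
  unfold birkhoffAverage birkhoffSum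
  simp only [_root_.id]
  filter_upwards [Lp.coeFn_smul ((n : ℝ)⁻¹) (∑ i ∈ Finset.range n,
        (Lp.compMeasurePreserving (E := ℝ) (p := 2) σ hσ)^[i] (hφ.toLp φ)), hsum n] with x h1 h2
  rw [h1, Pi.smul_apply, h2]
  rfl

theorem integral_birkAvg {σ : Y → Y} {μ : Measure Y} (hσ : MeasurePreserving σ μ μ)
    {φ : Y → ℝ} (hφ : Integrable φ μ) {n : ℕ} (hn : n ≠ 0) :
    ∫ y, birkAvg σ φ n y ∂μ = ∫ y, φ y ∂μ := by
  have h : ∀ i : ℕ, ∫ y, φ (σ^[i] y) ∂μ = ∫ y, φ y ∂μ := by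
    intro i
    have h1 := hσ.iterate i
    rw [← integral_map (f := φ) h1.measurable.aemeasurable, h1.map_eq]
    rw [h1.map_eq]
    exact hφ.aestronglyMeasurable
  unfold birkAvg birkhoff
  rw [integral_const_mul, integral_finsetSum]
  · simp [h, hn]
  · intro i _
    exact (hσ.iterate i).integrable_comp_of_integrable hφ

/-- The **mean ergodic theorem**: Birkhoff averages of a square integrable function under an
ergodic map converge in `L¹` to the space average. -/
theorem tendsto_integral_abs_birkAvg_sub {σ : Y → Y} {μ : Measure Y} [IsProbabilityMeasure μ]
    (hσ : Ergodic σ μ) {φ : Y → ℝ} (hφ : MemLp φ 2 μ) :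
    Tendsto (fun n => ∫ y, |birkAvg σ φ n y - ∫ z, φ z ∂μ| ∂μ) atTop (𝓝 0) := by
  have hmp : MeasurePreserving σ μ μ := hσ.toMeasurePreserving
  have hint : Integrable φ μ := hφ.integrable (by norm_num)
  let U : Lp ℝ 2 μ →L[ℝ] Lp ℝ 2 μ :=
    (Lp.compMeasurePreservingₗᵢ (E := ℝ) (p := 2) ℝ σ hmp).toContinuousLinearMap
  have hU : ‖U‖ ≤ 1 := LinearIsometry.norm_toContinuousLinearMap_le _
  have hlim := U.tendsto_birkhoffAverage_orthogonalProjection hU (hφ.toLp φ)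
  set P := (U.eqLocus (1 : Lp ℝ 2 μ →L[ℝ] Lp ℝ 2 μ)).orthogonalProjectionOnto (hφ.toLp φ) with hP
  have hPfix : Lp.compMeasurePreserving σ hmp (P : Lp ℝ 2 μ) = P := P.2
  obtain ⟨c, hc⟩ : ∃ c, ((P : Lp ℝ 2 μ) : Y → ℝ) =ᵐ[μ] Function.const Y c := by
    refine hσ.ae_eq_const_of_ae_eq_comp_ae (Lp.aestronglyMeasurable _) ?_
    have := Lp.coeFn_compMeasurePreserving (P : Lp ℝ 2 μ) hmp
    rw [hPfix] at this
    exact this.symm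
  have hae : ∀ n, (birkhoffAverage ℝ U _root_.id n (hφ.toLp φ) : Lp ℝ 2 μ) =ᵐ[μ] birkAvg σ φ n :=
    fun n => birkhoffAverage_compMeasurePreserving_ae_eq hmp hφ n
  have hle : ∀ n, ∫ y, |birkAvg σ φ n y - c| ∂μ ≤
      ‖birkhoffAverage ℝ U _root_.id n (hφ.toLp φ) - (P : Lp ℝ 2 μ)‖ := by
    intro n
    set g := birkhoffAverage ℝ U _root_.id n (hφ.toLp φ) - (P : Lp ℝ 2 μ) with hg
    have h1 : (fun y => |birkAvg σ φ n y - c|) =ᵐ[μ] fun y => ‖g y‖ := by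
      filter_upwards [hae n, hc, Lp.coeFn_sub (birkhoffAverage ℝ U _root_.id n (hφ.toLp φ))
        (P : Lp ℝ 2 μ)] with y h1 h2 h3
      rw [hg, h3, Pi.sub_apply, h1, h2, Real.norm_eq_abs]
      rfl
    rw [integral_congr_ae h1, integral_norm_eq_lintegral_enorm (Lp.aestronglyMeasurable _),
      ← eLpNorm_one_eq_lintegral_enorm, Lp.norm_def]
    exact ENNReal.toReal_mono (Lp.eLpNorm_ne_top _)
      (eLpNorm_le_eLpNorm_of_exponent_le (by norm_num) (Lp.aestronglyMeasurable _))
  have hz : Tendsto (fun n => ∫ y, |birkAvg σ φ n y - c| ∂μ) atTop (𝓝 0) :=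
    squeeze_zero (fun n => integral_nonneg fun _ => abs_nonneg _) hle
      (tendsto_iff_norm_sub_tendsto_zero.1 hlim)
  have hbint : ∀ n, Integrable (birkAvg σ φ n) μ := fun n =>
    ((integrable_finsetSum _ fun i _ =>
      (hmp.iterate i).integrable_comp_of_integrable hint).const_mul _)
  have hcφ : c = ∫ z, φ z ∂μ := by
    have h0 : |(∫ z, φ z ∂μ) - c| ≤ 0 := by
      refine ge_of_tendsto hz ?_
      filter_upwards [eventually_ne_atTop 0] with n hn
      calc |(∫ z, φ z ∂μ) - c| = |∫ y, (birkAvg σ φ n y - c) ∂μ| := by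
            rw [integral_sub (hbint n) (integrable_const _), integral_birkAvg hmp hint hn]
            simp
        _ ≤ _ := abs_integral_le_integral_abs
    exact (sub_eq_zero.1 (abs_nonpos_iff.1 h0)).symm
  rw [← hcφ]
  exact hz

end Ergodic

theorem integral_empiric {Y : Type*} [MeasurableSpace Y] (σ : Y → Y) (n : ℕ) (x : Y)
    {φ : Y → ℝ} (hφ : StronglyMeasurable φ) :
    ∫ y, φ y ∂(empiric σ n x) = birkAvg σ φ n x := by
  unfold empiric birkAvg birkhoff
  rw [integral_smul_measure, integral_finsetSum_measure]
  · simp [integral_dirac' _ _ hφ]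
  · intro i _
    exact ⟨hφ.aestronglyMeasurable, by
      simp [HasFiniteIntegral, lintegral_dirac' _ hφ.enorm]⟩

theorem abs_birkAvg_le_one {Y : Type*} (σ : Y → Y) {φ : Y → ℝ} (hφ : ∀ y, |φ y| ≤ 1)
    (n : ℕ) (x : Y) : |birkAvg σ φ n x| ≤ 1 := by
  unfold birkAvg birkhoff
  rcases Nat.eq_zero_or_pos n with rfl | hn
  · simp
  have hn' : (0 : ℝ) < n := by exact_mod_cast hn
  rw [abs_mul, abs_of_pos (inv_pos.2 hn'), inv_mul_le_iff₀ hn', mul_one]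
  refine (Finset.abs_sum_le_sum_abs _ _).trans ?_
  simpa using Finset.sum_le_sum fun i (_ : i ∈ Finset.range n) => hφ (σ^[i] x)

section Entropy

/-- If a finite probability vector gives mass `m` to a set `G`, its entropy is at most
`log 2 + m log |G| + (1 - m) log |W|`. -/
theorem sum_negMulLog_le {W : Type*} [Fintype W] [DecidableEq W] (p : W → ℝ) (hp : ∀ w, 0 ≤ p w)
    (hsum : ∑ w, p w = 1) (G : Finset W) :
    ∑ w, Real.negMulLog (p w) ≤ Real.log 2 + (∑ w ∈ G, p w) * Real.log G.card +
      (∑ w ∈ Gᶜ, p w) * Real.log (Fintype.card W) := by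
  have key : ∀ (x : ℝ) (N : ℕ), 0 ≤ x → 0 < N →
      Real.negMulLog x ≤ x * Real.log 2 + x * Real.log N + ((2 * N : ℝ)⁻¹ - x) := by
    intro x N hx hN
    have hN' : (0 : ℝ) < N := by exact_mod_cast hN
    rcases hx.eq_or_lt with rfl | hx
    · simp
    have h1 := Real.log_le_sub_one_of_pos (x := (2 * N : ℝ)⁻¹ / x) (by positivity)
    rw [Real.log_div (by positivity) hx.ne', Real.log_inv,
      Real.log_mul two_ne_zero hN'.ne'] at h1
    have h2 := mul_le_mul_of_nonneg_left h1 hx.le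
    rw [mul_sub, mul_sub, mul_one, mul_div_cancel₀ _ hx.ne'] at h2
    unfold Real.negMulLog
    linarith
  have part : ∀ (S : Finset W) (N : ℕ), S.card ≤ N →
      ∑ w ∈ S, Real.negMulLog (p w) ≤
        (∑ w ∈ S, p w) * Real.log 2 + (∑ w ∈ S, p w) * Real.log N +
          (2⁻¹ - ∑ w ∈ S, p w) := by
    intro S N hS
    rcases S.eq_empty_or_nonempty with rfl | hne
    · simp
    have hN : 0 < N := hne.card_pos.trans_le hS
    have hN' : (0 : ℝ) < N := by exact_mod_cast hN
    refine (Finset.sum_le_sum fun w _ => key (p w) N (hp w) hN).trans ?_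
    rw [Finset.sum_add_distrib, Finset.sum_add_distrib, Finset.sum_sub_distrib,
      ← Finset.sum_mul, ← Finset.sum_mul, Finset.sum_const, nsmul_eq_mul]
    have : (S.card : ℝ) * (2 * N : ℝ)⁻¹ ≤ 2⁻¹ := by
      rw [mul_inv, ← mul_assoc, mul_comm (S.card : ℝ), mul_assoc, ← div_eq_mul_inv]
      have : (S.card : ℝ) / N ≤ 1 := (div_le_one hN').2 (by exact_mod_cast hS)
      linarith
    linarith
  have h1 := part G G.card le_rfl
  have h2 := part Gᶜ (Fintype.card W) (Finset.card_le_univ _)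
  have h3 := Finset.sum_add_sum_compl G p
  have h4 := Finset.sum_add_sum_compl G fun w => Real.negMulLog (p w)
  rw [hsum] at h3
  have h5 : (∑ w ∈ G, p w) * Real.log 2 + (∑ w ∈ Gᶜ, p w) * Real.log 2 = Real.log 2 := by
    rw [← add_mul, h3, one_mul]
  linarith

end Entropy

section Shift

theorem subShift_iterate_val {A : Type} {X : Set (ℕ → A)} (hX : Set.MapsTo shift X X)
    (i : ℕ) (x : ↥X) : ((subShift X)^[i] x).val = fun j => x.val (j + i) := by
  induction i generalizing x with
  | zero => rfl
  | succ i ih =>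
    rw [Function.iterate_succ_apply, ih]
    funext j
    simp [subShift, hX x.2, shift, add_assoc]

theorem continuous_subShift {A : Type} [TopologicalSpace A] {X : Set (ℕ → A)} (hX : Set.MapsTo shift X X) : Continuous (subShift X) := by
  have : subShift X = fun x : ↥X => ⟨shift x.val, hX x.2⟩ := by
    funext x
    simp [subShift, hX x.2]
  rw [this]
  refine Continuous.subtype_mk ?_ _
  exact continuous_pi fun i => (continuous_apply (i + 1)).comp continuous_subtype_val

theorem continuous_birkAvg {Y : Type*} [TopologicalSpace Y] {σ : Y → Y} (hσ : Continuous σ)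
    {φ : Y → ℝ} (hφ : Continuous φ) (n : ℕ) : Continuous (birkAvg σ φ n) := by
  unfold birkAvg birkhoff
  exact continuous_const.mul (continuous_finsetSum _ fun i _ => hφ.comp (hσ.iterate i))

/-- A continuous function on a compact subset of `A^ℕ` has a modulus of continuity with respect
to the length of the common prefix. -/
theorem exists_modulus {A : Type} [TopologicalSpace A] [DiscreteTopology A] {X : Set (ℕ → A)}
    [CompactSpace ↥X] {φ : ↥X → ℝ}
    (hφ : Continuous φ) (h01 : ∀ x, φ x ∈ Set.Icc (0 : ℝ) 1) :
    ∃ c : ℕ → ℝ, Tendsto c atTop (𝓝 0) ∧ (∀ j, 0 ≤ c j) ∧ (∀ j, c j ≤ 1) ∧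
      ∀ j (x y : ↥X), (∀ i < j, x.val i = y.val i) → |φ x - φ y| ≤ c j := by
  have hle1 : ∀ x y, |φ x - φ y| ≤ 1 := fun x y => by
    have := h01 x; have := h01 y
    simp only [Set.mem_Icc] at *
    rw [abs_le]; constructor <;> linarith
  let c : ℕ → ℝ := fun j =>
    ⨆ q : {q : ↥X × ↥X // ∀ i < j, q.1.val i = q.2.val i}, |φ q.1.1 - φ q.1.2|
  have hc0 : ∀ j, 0 ≤ c j := fun j => Real.iSup_nonneg fun _ => abs_nonneg _
  refine ⟨c, ?_, hc0, fun j => Real.iSup_le (fun _ => hle1 _ _) zero_le_one, ?_⟩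
  · rw [Metric.tendsto_atTop]
    intro η hη
    let K : ℕ → Set (↥X × ↥X) := fun j =>
      {q | (∀ i < j, q.1.val i = q.2.val i) ∧ η / 2 ≤ |φ q.1 - φ q.2|}
    have hKcl : ∀ j, IsClosed (K j) := by
      intro j
      refine IsClosed.inter ?_ (isClosed_le continuous_const
        ((hφ.comp continuous_fst).sub (hφ.comp continuous_snd)).abs)
      have : {q : ↥X × ↥X | ∀ i < j, q.1.val i = q.2.val i} =
          ⋂ i, ⋂ (_ : i < j), {q : ↥X × ↥X | q.1.val i = q.2.val i} := by
        ext; simp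
      change IsClosed {q : ↥X × ↥X | ∀ i < j, q.1.val i = q.2.val i}
      rw [this]
      exact isClosed_iInter fun i => isClosed_iInter fun _ =>
        isClosed_eq ((continuous_apply i).comp (continuous_subtype_val.comp continuous_fst))
          ((continuous_apply i).comp (continuous_subtype_val.comp continuous_snd))
    obtain ⟨J, hJ⟩ : ∃ J, K J = ∅ := by
      by_contra! hne
      obtain ⟨q, hq⟩ := IsCompact.nonempty_iInter_of_sequence_nonempty_isCompact_isClosed K
        (fun j q hq => ⟨fun i hi => hq.1 i (hi.trans (Nat.lt_succ_self j)), hq.2⟩) hne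
        (hKcl 0).isCompact hKcl
      rw [Set.mem_iInter] at hq
      have : q.1 = q.2 := Subtype.ext (funext fun i => (hq (i + 1)).1 i (Nat.lt_succ_self i))
      have h2 := (hq 0).2
      rw [this] at h2
      simp at h2
      linarith
    refine ⟨J, fun j hj => ?_⟩
    rw [Real.dist_eq, sub_zero, abs_of_nonneg (hc0 j)]
    refine (Real.iSup_le (fun q => ?_) (half_pos hη).le).trans_lt (half_lt_self hη)
    by_contra! hlt
    have : q.1 ∈ K J := ⟨fun i hi => q.2 i (hi.trans_le hj), hlt.le⟩
    rw [hJ] at this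
    exact this
  · intro j x y hxy
    refine le_ciSup (f := fun q : {q : ↥X × ↥X // ∀ i < j, q.1.val i = q.2.val i} =>
      |φ q.1.1 - φ q.1.2|) ⟨1, ?_⟩ ⟨(x, y), hxy⟩
    rintro _ ⟨q, rfl⟩
    exact hle1 _ _

theorem abs_birkAvg_sub_le {A : Type} {X : Set (ℕ → A)} (hX : Set.MapsTo shift X X) {φ : ↥X → ℝ} {c : ℕ → ℝ}
    (hc : ∀ j (x y : ↥X), (∀ i < j, x.val i = y.val i) → |φ x - φ y| ≤ c j)
    (n : ℕ) (x y : ↥X) (hxy : ∀ i < n, x.val i = y.val i) :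
    |birkAvg (subShift X) φ n x - birkAvg (subShift X) φ n y| ≤
      (n : ℝ)⁻¹ * ∑ i ∈ Finset.range n, c i := by
  unfold birkAvg birkhoff
  rw [← mul_sub, abs_mul, abs_of_nonneg (by positivity), ← Finset.sum_sub_distrib,
    ← Finset.sum_range_reflect c]
  refine mul_le_mul_of_nonneg_left ?_ (by positivity)
  refine (Finset.abs_sum_le_sum_abs _ _).trans (Finset.sum_le_sum fun i hi => ?_)
  refine hc _ _ _ fun l hl => ?_
  rw [subShift_iterate_val hX, subShift_iterate_val hX]
  exact hxy _ (by have := Finset.mem_range.1 hi; omega)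

end Shift

theorem cylinder_ofFn {A : Type} {n : ℕ} (v : Fin n → A) : cylinder (List.ofFn v) = cylF v := by
  ext x
  simp only [cylinder, cylF, Set.mem_ofPred_eq]
  constructor
  · intro h i
    have := h (Fin.cast (by simp) i)
    simpa using this
  · intro h i
    rw [List.get_ofFn]
    exact h (Fin.cast (by simp) i)

theorem summable_inv_two_pow_succ : Summable fun k : ℕ => ((2 : ℝ) ^ (k + 1))⁻¹ := by
  have := (summable_nat_add_iff (f := fun k : ℕ => ((1 : ℝ) / 2) ^ k) 1).2
    summable_geometric_two
  simpa using this

theorem tendsto_tsum_inv_two_pow_mul {a : ℕ → ℕ → ℝ} (h0 : ∀ k n, 0 ≤ a k n)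
    {B : ℝ} (hB : ∀ k n, a k n ≤ B) (ha : ∀ k, Tendsto (a k) atTop (𝓝 0)) :
    Tendsto (fun n => ∑' k, ((2 : ℝ) ^ (k + 1))⁻¹ * a k n) atTop (𝓝 0) := by
  have := tendsto_tsum_of_dominated_convergence (𝓕 := atTop)
    (f := fun n k => ((2 : ℝ) ^ (k + 1))⁻¹ * a k n) (g := fun _ => 0)
    (summable_inv_two_pow_succ.mul_right B)
    (fun k => by simpa using (ha k).const_mul ((2 : ℝ) ^ (k + 1))⁻¹)
    (Eventually.of_forall fun n k => by
      rw [Real.norm_of_nonneg (mul_nonneg (by positivity) (h0 k n))]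
      exact mul_le_mul_of_nonneg_left (hB k n) (by positivity))
  simpa using this

theorem pairwise_disjoint_preimage_cylF {A : Type} (X : Set (ℕ → A)) (n : ℕ) :
    Pairwise (Function.onFun Disjoint
      fun v : Fin n → A => (Subtype.val : ↥X → ℕ → A) ⁻¹' cylF v) := by
  intro v w hvw
  refine Set.disjoint_left.2 fun x hx hy => hvw (funext fun i => ?_)
  exact (hx i).symm.trans (hy i)

theorem mul_entropy_le_wordEntropy {A : Type} [Fintype A] [MeasurableSpace A]
    (X : Set (ℕ → A)) (μ : ProbabilityMeasure ↥X) {n : ℕ}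
    (hn : 0 < n) : n * entropy X μ ≤ wordEntropy X μ n := by
  have hn' : (0 : ℝ) < n := by exact_mod_cast hn
  obtain ⟨m, rfl⟩ := Nat.exists_eq_succ_of_ne_zero hn.ne'
  have h : entropy X μ ≤ wordEntropy X μ (m + 1) / ((m : ℝ) + 1) := by
    refine ciInf_le (f := fun n : ℕ => wordEntropy X μ (n + 1) / ((n : ℝ) + 1)) ⟨0, ?_⟩ m
    rintro _ ⟨k, rfl⟩
    refine div_nonneg (Finset.sum_nonneg fun v _ => ?_) (by positivity)
    exact Real.negMulLog_nonneg ENNReal.toReal_nonneg measureReal_le_one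
  rw [le_div_iff₀ (by positivity)] at h
  push_cast at hn' ⊢
  linarith

section Count

variable {A : Type} [Fintype A] [TopologicalSpace A] [DiscreteTopology A]
  [MeasurableSpace A] [BorelSpace A]

theorem measurableSet_preimage_cylF (X : Set (ℕ → A)) {n : ℕ} (v : Fin n → A) :
    MeasurableSet ((Subtype.val : ↥X → ℕ → A) ⁻¹' cylF v) := by
  refine measurable_subtype_coe ?_
  have : cylF v = ⋂ i : Fin n, (fun x : ℕ → A => x i) ⁻¹' {v i} := by
    ext; simp [cylF]
  rw [this]
  exact MeasurableSet.iInter fun i => measurable_pi_apply _ (measurableSet_singleton _)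

theorem sum_measureReal_cylF (X : Set (ℕ → A)) (μ : ProbabilityMeasure ↥X) {n : ℕ}
    (S : Finset (Fin n → A)) :
    ∑ v ∈ S, (μ.toMeasure (Subtype.val ⁻¹' cylF v)).toReal =
      μ.toMeasure.real (⋃ v ∈ S, Subtype.val ⁻¹' cylF v) := by
  rw [measureReal_biUnion_finset
    (fun v _ w _ h => pairwise_disjoint_preimage_cylF X n h)
    (fun v _ => measurableSet_preimage_cylF X v)]
  rfl

/-- A set of words whose cylinders carry almost full measure has cardinality bounded below in
terms of the entropy. -/
theorem exp_le_card [DecidableEq A] (X : Set (ℕ → A)) (μ : ProbabilityMeasure ↥X) {n : ℕ} (hn : 0 < n)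
    (G : Finset (Fin n → A)) {δ : ℝ}
    (hlt : μ.toMeasure.real (⋃ v ∈ Gᶜ, Subtype.val ⁻¹' cylF v) < 1)
    (hδ : Real.log 2 + μ.toMeasure.real (⋃ v ∈ Gᶜ, Subtype.val ⁻¹' cylF v) *
      (n * Real.log (Fintype.card A)) ≤ n * δ) :
    Real.exp (n * (entropy X μ - δ)) ≤ G.card := by
  set p : (Fin n → A) → ℝ := fun v => (μ.toMeasure (Subtype.val ⁻¹' cylF v)).toReal with hp
  have hp0 : ∀ v, 0 ≤ p v := fun v => ENNReal.toReal_nonneg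
  have hsum : ∑ v, p v = 1 := by
    rw [hp, sum_measureReal_cylF]
    have : (⋃ v ∈ (Finset.univ : Finset (Fin n → A)),
        (Subtype.val : ↥X → ℕ → A) ⁻¹' cylF v) = Set.univ := by
      refine Set.eq_univ_of_forall fun x => ?_
      simp only [Set.mem_iUnion]
      exact ⟨fun i => x.val i, Finset.mem_univ _, fun i => rfl⟩
    rw [this]
    simp
  have hcompl : ∑ v ∈ Gᶜ, p v = μ.toMeasure.real (⋃ v ∈ Gᶜ, Subtype.val ⁻¹' cylF v) :=
    sum_measureReal_cylF X μ _
  rw [← hcompl] at hlt hδ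
  have hadd := Finset.sum_add_sum_compl G p
  have hG : G.Nonempty := by
    rw [Finset.nonempty_iff_ne_empty]
    rintro rfl
    simp only [Finset.sum_empty, zero_add] at hadd
    linarith
  have hG1 : (1 : ℝ) ≤ G.card := by exact_mod_cast hG.card_pos
  have hH := sum_negMulLog_le p hp0 hsum G
  have hent := mul_entropy_le_wordEntropy X μ hn
  have hc0 : 0 ≤ ∑ v ∈ Gᶜ, p v := Finset.sum_nonneg fun v _ => hp0 v
  have hmul : (∑ v ∈ G, p v) * Real.log G.card ≤ Real.log G.card := by
    refine mul_le_of_le_one_left (Real.log_nonneg hG1) ?_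
    linarith
  have hcard : Real.log (Fintype.card (Fin n → A)) = n * Real.log (Fintype.card A) := by
    simp
  rw [hcard] at hH
  rw [← Real.le_log_iff_exp_le (by linarith)]
  have : wordEntropy X μ n = ∑ v, Real.negMulLog (p v) := rfl
  rw [mul_sub]
  linarith

end Count

theorem abs_birkAvg_sub_integral_le_two {A : Type} [TopologicalSpace A] [MeasurableSpace A]
    {X : Set (ℕ → A)} {f : ℕ → C(↥X, ℝ)}
    (hf01 : ∀ k x, f k x ∈ Set.Icc (0 : ℝ) 1) (μ : ProbabilityMeasure ↥X) (k n : ℕ) (x : ↥X) :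
    |birkAvg (subShift X) (f k) n x - ∫ y, f k y ∂μ.toMeasure| ≤ 2 := by
  have hf1 : ∀ y, |f k y| ≤ 1 := fun y => abs_le.2 ⟨by linarith [(hf01 k y).1], (hf01 k y).2⟩
  have h1 := abs_birkAvg_le_one (subShift X) hf1 n x
  have h2 : |∫ y, f k y ∂μ.toMeasure| ≤ 1 := by
    simpa using norm_integral_le_of_norm_le_const (μ := μ.toMeasure)
      (f := f k) (C := 1) (Eventually.of_forall hf1)
  rw [abs_le] at *
  constructor <;> linarith

theorem summable_Dmetric_empiric {A : Type} [TopologicalSpace A] [MeasurableSpace A]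
    {X : Set (ℕ → A)} {f : ℕ → C(↥X, ℝ)}
    (hf01 : ∀ k x, f k x ∈ Set.Icc (0 : ℝ) 1) (μ : ProbabilityMeasure ↥X) (n : ℕ) (x : ↥X) :
    Summable fun k : ℕ => ((2 : ℝ) ^ (k + 1))⁻¹ *
      |birkAvg (subShift X) (f k) n x - ∫ y, f k y ∂μ.toMeasure| :=
  Summable.of_nonneg_of_le (fun k => by positivity)
    (fun k => mul_le_mul_of_nonneg_left (abs_birkAvg_sub_integral_le_two hf01 μ k n x)
      (by positivity)) (summable_inv_two_pow_succ.mul_right 2)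

section Distance

variable {A : Type} [Fintype A] [TopologicalSpace A] [DiscreteTopology A]
  [MeasurableSpace A] [BorelSpace A] {X : Set (ℕ → A)}

theorem Dmetric_empiric (f : ℕ → C(↥X, ℝ)) (n : ℕ) (x : ↥X) (μ : Measure ↥X) :
    Dmetric f (empiric (subShift X) n x) μ =
      ∑' k : ℕ, ((2 : ℝ) ^ (k + 1))⁻¹ *
        |birkAvg (subShift X) (f k) n x - ∫ y, f k y ∂μ| := by
  unfold Dmetric
  congr 1
  funext k
  rw [integral_empiric _ _ _ (f k).continuous.stronglyMeasurable]

theorem continuous_Dmetric_empiric (hX : Set.MapsTo shift X X) {f : ℕ → C(↥X, ℝ)}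
    (hf01 : ∀ k x, f k x ∈ Set.Icc (0 : ℝ) 1) (μ : ProbabilityMeasure ↥X) (n : ℕ) :
    Continuous fun x => Dmetric f (empiric (subShift X) n x) μ.toMeasure := by
  simp_rw [Dmetric_empiric]
  refine continuous_tsum (fun k => ?_) (summable_inv_two_pow_succ.mul_right 2) fun k x => ?_
  · exact continuous_const.mul (((continuous_birkAvg (continuous_subShift hX)
      (f k).continuous n).sub continuous_const).abs)
  · rw [Real.norm_of_nonneg (by positivity)]
    exact mul_le_mul_of_nonneg_left (abs_birkAvg_sub_integral_le_two hf01 μ k n x)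
      (by positivity)

theorem Dmetric_nonneg {Y : Type*} [MeasurableSpace Y] [TopologicalSpace Y]
    (f : ℕ → C(Y, ℝ)) (μ ν : Measure Y) : 0 ≤ Dmetric f μ ν :=
  tsum_nonneg fun k => by positivity

theorem tendsto_integral_Dmetric_empiric [CompactSpace ↥X] (hX : Set.MapsTo shift X X)
    {f : ℕ → C(↥X, ℝ)} (hf01 : ∀ k x, f k x ∈ Set.Icc (0 : ℝ) 1) (μ : ProbabilityMeasure ↥X)
    (herg : Ergodic (subShift X) μ.toMeasure) :
    Tendsto (fun n => ∫ x, Dmetric f (empiric (subShift X) n x) μ.toMeasure ∂μ.toMeasure)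
      atTop (𝓝 0) := by
  have hcont : ∀ k n, Continuous fun x =>
      |birkAvg (subShift X) (f k) n x - ∫ y, f k y ∂μ.toMeasure| := fun k n =>
    ((continuous_birkAvg (continuous_subShift hX) (f k).continuous n).sub continuous_const).abs
  have hint : ∀ k n, Integrable (fun x =>
      |birkAvg (subShift X) (f k) n x - ∫ y, f k y ∂μ.toMeasure|) μ.toMeasure := fun k n =>
    (hcont k n).integrable_of_hasCompactSupport (HasCompactSupport.of_compactSpace _)
  have hle : ∀ k n, ∫ x, |birkAvg (subShift X) (f k) n x - ∫ y, f k y ∂μ.toMeasure|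
      ∂μ.toMeasure ≤ 2 := fun k n => by
    simpa using integral_mono (hint k n) (integrable_const 2)
      (abs_birkAvg_sub_integral_le_two hf01 μ k n)
  have hnn : ∀ k n, 0 ≤ ∫ x, |birkAvg (subShift X) (f k) n x - ∫ y, f k y ∂μ.toMeasure|
      ∂μ.toMeasure := fun k n => integral_nonneg fun _ => abs_nonneg _
  have heq : ∀ n, ∫ x, Dmetric f (empiric (subShift X) n x) μ.toMeasure ∂μ.toMeasure =
      ∑' k : ℕ, ((2 : ℝ) ^ (k + 1))⁻¹ *
        ∫ x, |birkAvg (subShift X) (f k) n x - ∫ y, f k y ∂μ.toMeasure| ∂μ.toMeasure := by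
    intro n
    simp_rw [Dmetric_empiric]
    rw [← integral_tsum_of_summable_integral_norm]
    · simp_rw [integral_const_mul]
    · exact fun k => (hint k n).const_mul _
    · refine Summable.of_nonneg_of_le (fun k => integral_nonneg fun _ => norm_nonneg _)
        (fun k => ?_) (summable_inv_two_pow_succ.mul_right 2)
      simp only [norm_mul, norm_inv, norm_pow, Real.norm_ofNat, Real.norm_eq_abs, abs_abs]
      rw [integral_const_mul]
      exact mul_le_mul_of_nonneg_left (hle k n) (by positivity)
  simp_rw [heq]
  refine tendsto_tsum_inv_two_pow_mul hnn hle fun k => ?_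
  refine tendsto_integral_abs_birkAvg_sub herg ?_
  exact (f k).continuous.memLp_of_hasCompactSupport (HasCompactSupport.of_compactSpace _)

/-- Points sharing a long prefix have uniformly close empirical measures. -/
theorem exists_Dmetric_empiric_modulus [CompactSpace ↥X] (hX : Set.MapsTo shift X X)
    {f : ℕ → C(↥X, ℝ)} (hf01 : ∀ k x, f k x ∈ Set.Icc (0 : ℝ) 1) (μ : ProbabilityMeasure ↥X) :
    ∃ s : ℕ → ℝ, Tendsto s atTop (𝓝 0) ∧ ∀ n (x y : ↥X), (∀ i < n, x.val i = y.val i) →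
      Dmetric f (empiric (subShift X) n x) μ.toMeasure ≤
        Dmetric f (empiric (subShift X) n y) μ.toMeasure + s n := by
  choose c hc0 hcnn hc1 hc using fun k => exists_modulus (f k).continuous (hf01 k)
  have hosc1 : ∀ k n : ℕ, (n : ℝ)⁻¹ * ∑ i ∈ Finset.range n, c k i ≤ 1 := by
    intro k n
    rcases Nat.eq_zero_or_pos n with rfl | hn
    · simp
    have hn' : (0 : ℝ) < n := by exact_mod_cast hn
    rw [inv_mul_le_iff₀ hn', mul_one]
    simpa using Finset.sum_le_sum fun i (_ : i ∈ Finset.range n) => hc1 k i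
  have hosc0 : ∀ k n : ℕ, 0 ≤ (n : ℝ)⁻¹ * ∑ i ∈ Finset.range n, c k i := fun k n =>
    mul_nonneg (by positivity) (Finset.sum_nonneg fun i _ => hcnn k i)
  refine ⟨fun n => ∑' k : ℕ, ((2 : ℝ) ^ (k + 1))⁻¹ *
    ((n : ℝ)⁻¹ * ∑ i ∈ Finset.range n, c k i),
    tendsto_tsum_inv_two_pow_mul hosc0 hosc1 fun k => (hc0 k).cesaro, ?_⟩
  intro n x y hxy
  have hs : Summable fun k : ℕ => ((2 : ℝ) ^ (k + 1))⁻¹ *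
      ((n : ℝ)⁻¹ * ∑ i ∈ Finset.range n, c k i) :=
    Summable.of_nonneg_of_le (fun k => mul_nonneg (by positivity) (hosc0 k n))
      (fun k => mul_le_mul_of_nonneg_left (hosc1 k n) (by positivity))
      (summable_inv_two_pow_succ.mul_right 1)
  rw [Dmetric_empiric, Dmetric_empiric, ← (summable_Dmetric_empiric hf01 μ n y).tsum_add hs]
  refine (summable_Dmetric_empiric hf01 μ n x).tsum_le_tsum (fun k => ?_)
    ((summable_Dmetric_empiric hf01 μ n y).add hs)
  rw [← mul_add]
  refine mul_le_mul_of_nonneg_left ?_ (by positivity)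
  have h1 := abs_birkAvg_sub_le hX (hc k) n x y hxy
  have h2 := abs_sub_le (birkAvg (subShift X) (f k) n x) (birkAvg (subShift X) (f k) n y)
    (∫ y, f k y ∂μ.toMeasure)
  linarith

end Distance

/-- lower counting bound for words whose cylinder consists of points with
empirical measure `ε`-close to an ergodic measure `μ`. -/
theorem statement_9 {A : Type} [Fintype A] [DecidableEq A] [TopologicalSpace A]
    [DiscreteTopology A] [MeasurableSpace A] [BorelSpace A]
    (X : Set (ℕ → A)) (hXcl : IsClosed X) (hXinv : Set.MapsTo shift X X)
    (f : ℕ → C(↥X, ℝ)) (hf01 : ∀ k x, f k x ∈ Set.Icc (0 : ℝ) 1) (hsep : Separating f)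
    (μ : ProbabilityMeasure ↥X) (herg : Ergodic (subShift X) μ.toMeasure)
    (ε δ : ℝ) (hε : 0 < ε) (hδ : 0 < δ) :
    ∃ N : ℕ, ∀ n : ℕ, N ≤ n →
      Real.exp (n * (entropy X μ - δ)) ≤
        (({w ∈ language X | w.length = n ∧ ∀ x : ↥X, x.val ∈ cylinder w →
            Dmetric f (empiric (subShift X) n x) μ.toMeasure < ε}.ncard : ℝ)) := by
  have hcomp : CompactSpace ↥X := isCompact_iff_compactSpace.1 hXcl.isCompact
  obtain ⟨s, hs0, hs⟩ := exists_Dmetric_empiric_modulus hXinv hf01 μ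
  have hE := tendsto_integral_Dmetric_empiric hXinv hf01 μ herg
  set E : ℕ → ℝ := fun n =>
    ∫ x, Dmetric f (empiric (subShift X) n x) μ.toMeasure ∂μ.toMeasure with hEdef
  have hm0 : Tendsto (fun n => 2 / ε * E n) atTop (𝓝 0) := by
    simpa using hE.const_mul (2 / ε)
  have hsmall : Tendsto (fun n : ℕ => Real.log 2 / n + 2 / ε * E n * Real.log (Fintype.card A))
      atTop (𝓝 0) := by
    simpa using (tendsto_const_div_atTop_nhds_zero_nat (Real.log 2)).add
      (hm0.mul_const (Real.log (Fintype.card A)))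
  have hev : ∀ᶠ n : ℕ in atTop, 0 < n ∧ s n < ε / 2 ∧ 2 / ε * E n < 1 ∧
      Real.log 2 / n + 2 / ε * E n * Real.log (Fintype.card A) < δ := by
    filter_upwards [eventually_gt_atTop 0, hs0.eventually (gt_mem_nhds (half_pos hε)),
      hm0.eventually (gt_mem_nhds one_pos), hsmall.eventually (gt_mem_nhds hδ)]
      with n h1 h2 h3 h4 using ⟨h1, h2, h3, h4⟩
  obtain ⟨N, hN⟩ := eventually_atTop.1 hev
  refine ⟨N, fun n hn => ?_⟩
  obtain ⟨hn0, hsn, hm1, hnδ⟩ := hN n hn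
  have hn' : (0 : ℝ) < n := by exact_mod_cast hn0
  let G : Finset (Fin n → A) := Finset.univ.filter fun v =>
    (cylF v ∩ X).Nonempty ∧ ∀ x : ↥X, x.val ∈ cylF v →
      Dmetric f (empiric (subShift X) n x) μ.toMeasure < ε
  have hbad : μ.toMeasure.real (⋃ v ∈ Gᶜ, Subtype.val ⁻¹' cylF v) ≤ 2 / ε * E n := by
    have hsub : (⋃ v ∈ Gᶜ, (Subtype.val : ↥X → ℕ → A) ⁻¹' cylF v) ⊆
        {x | ε / 2 ≤ Dmetric f (empiric (subShift X) n x) μ.toMeasure} := by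
      intro y hy
      simp only [Set.mem_iUnion] at hy
      obtain ⟨v, hv, hyv⟩ := hy
      simp only [G, Finset.mem_compl, Finset.mem_filter, Finset.mem_univ, true_and,
        not_and] at hv
      have := hv ⟨y.val, hyv, y.2⟩
      push Not at this
      obtain ⟨x, hxv, hx⟩ := this
      have h1 := hs n x y fun i hi => (hxv ⟨i, hi⟩).trans (hyv ⟨i, hi⟩).symm
      simp only [Set.mem_ofPred_eq]
      linarith
    have hmarkov := mul_meas_ge_le_integral_of_nonneg (μ := μ.toMeasure)
      (f := fun x => Dmetric f (empiric (subShift X) n x) μ.toMeasure)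
      (Eventually.of_forall fun x => Dmetric_nonneg _ _ _)
      ((continuous_Dmetric_empiric hXinv hf01 μ n).integrable_of_hasCompactSupport
        (HasCompactSupport.of_compactSpace _)) (ε / 2)
    refine (measureReal_mono hsub).trans ?_
    rw [div_mul_eq_mul_div, le_div_iff₀ hε]
    linarith
  have hlogA : 0 ≤ Real.log (Fintype.card A) := Real.log_natCast_nonneg _
  have hcount := exp_le_card X μ hn0 G (δ := δ) (hbad.trans_lt hm1) (by
    have h1 := mul_le_mul_of_nonneg_right hbad (mul_nonneg hn'.le hlogA)
    have h2 := mul_le_mul_of_nonneg_left hnδ.le hn'.le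
    rw [mul_add, mul_div_cancel₀ _ hn'.ne'] at h2
    linarith)
  refine hcount.trans ?_
  have hfin : {w ∈ language X | w.length = n ∧ ∀ x : ↥X, x.val ∈ cylinder w →
      Dmetric f (empiric (subShift X) n x) μ.toMeasure < ε}.Finite :=
    (List.finite_length_eq A n).subset fun w hw => hw.2.1
  have hsub : List.ofFn '' (G : Set (Fin n → A)) ⊆
      {w ∈ language X | w.length = n ∧ ∀ x : ↥X, x.val ∈ cylinder w →
        Dmetric f (empiric (subShift X) n x) μ.toMeasure < ε} := by
    rintro _ ⟨v, hv, rfl⟩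
    simp only [G, Finset.coe_filter, Finset.mem_univ, true_and, Set.mem_ofPred_eq] at hv
    simpa [language, cylinder_ofFn] using hv
  have hle := Set.ncard_le_ncard hsub hfin
  rw [Set.ncard_image_of_injective _ List.ofFn_injective, Set.ncard_coe_finset] at hle
  exact_mod_cast hle

end Paper
end

section
/- Let X be a shift space with language 𝓛 = 𝓛(X). Suppose 𝓖 ⊂ 𝓛 has (W)-specification and 𝓛 is edit approachable by 𝓖. Then for every σ-invariant Borel probability measure μ on X, the generic set G_μ(X,σ) = {x ∈ X : ℰ_n(x) → μ in the weak* topology} is non-empty. -/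
open MeasureTheory Filter Topology Set
open scoped ENNReal Classical

namespace Paper

variable {A : Type} [Fintype A] [DecidableEq A] [TopologicalSpace A] [DiscreteTopology A]
  [MeasurableSpace A] [BorelSpace A]

/-- A real-valued function on words that is additive under concatenation up to the error `C`. -/
structure QuasiAdditive {B : Type} (c : List B → ℝ) (C : ℝ) : Prop where
  append : ∀ v w, |c (v ++ w) - c v - c w| ≤ C
  single : ∀ a, |c [a]| ≤ C

namespace QuasiAdditive

variable {B : Type} {c : List B → ℝ} {C : ℝ}

lemma abs_nil_le (h : QuasiAdditive c C) : |c []| ≤ C := by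
  simpa using h.append [] []

lemma const_nonneg (h : QuasiAdditive c C) : 0 ≤ C := (abs_nonneg _).trans h.abs_nil_le

lemma abs_apply_le (h : QuasiAdditive c C) (w : List B) : |c w| ≤ C + 2 * C * w.length := by
  induction w with
  | nil => simpa using h.abs_nil_le
  | cons a w ih =>
    have h1 := abs_le.1 (h.append [a] w)
    have h2 := abs_le.1 (h.single a)
    have h3 := abs_le.1 ih
    simp only [List.singleton_append, List.length_cons, Nat.cast_add, Nat.cast_one] at *
    exact abs_le.2 ⟨by linarith [h1.1], by linarith [h1.2]⟩

lemma abs_sub_le_of_editStep (h : QuasiAdditive c C) {v w : List B} (hvw : EditStep v w) :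
    |c v - c w| ≤ 6 * C := by
  rcases hvw with ⟨u₁, u₂, a, a', rfl, rfl⟩ | ⟨u₁, u₂, a, rfl, rfl⟩ | ⟨u₁, u₂, a, rfl, rfl⟩
  · have h1 := abs_le.1 (h.append (u₁ ++ [a]) u₂)
    have h2 := abs_le.1 (h.append u₁ [a])
    have h3 := abs_le.1 (h.single a)
    have h4 := abs_le.1 (h.append (u₁ ++ [a']) u₂)
    have h5 := abs_le.1 (h.append u₁ [a'])
    have h6 := abs_le.1 (h.single a')
    exact abs_le.2 ⟨by linarith, by linarith⟩
  all_goals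
    have h0 := h.const_nonneg
    have h1 := abs_le.1 (h.append (u₁ ++ [a]) u₂)
    have h2 := abs_le.1 (h.append u₁ [a])
    have h3 := abs_le.1 (h.single a)
    have h4 := abs_le.1 (h.append u₁ u₂)
    exact abs_le.2 ⟨by linarith, by linarith⟩

end QuasiAdditive

lemma exists_editPath {B : Type} (v w : List B) :
    ∃ n, ∃ f : ℕ → List B, f 0 = v ∧ f n = w ∧ ∀ i < n, EditStep (f i) (f (i + 1)) := by
  refine ⟨v.length + w.length, fun i => if i ≤ v.length then v.drop i else
    w.drop (w.length - (i - v.length)), by simp, ?_, ?_⟩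
  · by_cases hw : w.length = 0
    · simp [List.length_eq_zero_iff.1 hw]
    · simp [hw]
  · intro i hi
    by_cases h1 : i < v.length
    · right; right
      refine ⟨[], v.drop (i + 1), v[i], ?_, ?_⟩
      · simp [h1.le]
      · simp [h1]
    · right; left
      have hk : w.length - (i + 1 - v.length) < w.length := by omega
      refine ⟨[], w.drop (w.length - (i - v.length)), w[w.length - (i + 1 - v.length)], ?_, ?_⟩
      · by_cases h2 : i = v.length
        · simp [h2]
        · simp [show ¬ i ≤ v.length by omega]
      · have : w.length - (i - v.length) = w.length - (i + 1 - v.length) + 1 := by omega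
        simp [show ¬ i + 1 ≤ v.length by omega, this]

lemma QuasiAdditive.abs_sub_le_editDist {B : Type} {c : List B → ℝ} {C : ℝ}
    (h : QuasiAdditive c C) (v w : List B) : |c v - c w| ≤ 6 * C * editDist v w := by
  obtain ⟨f, hf0, hfn, hf⟩ := Nat.sInf_mem (exists_editPath v w)
  change f (editDist v w) = w at hfn
  have key : ∀ n ≤ editDist v w, |c v - c (f n)| ≤ 6 * C * n := by
    intro n hn
    induction n with
    | zero => simp [hf0]
    | succ n ih =>
      have h1 := ih (by omega)
      have h2 := h.abs_sub_le_of_editStep (hf n hn)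
      have h3 := abs_sub_le (c v) (c (f n)) (c (f (n + 1)))
      push_cast
      linarith
  simpa [hfn] using key _ le_rfl

lemma quasiAdditive_length {B : Type} :
    QuasiAdditive (fun w : List B => (w.length : ℝ)) 1 :=
  ⟨fun v w => by simp, fun a => by simp⟩

/-- The number of occurrences of the word `u` in a word. -/
noncomputable def occ {B : Type} (u : List B) : List B → ℝ
  | [] => 0
  | a :: w => occ u w + if u <+: a :: w then 1 else 0

lemma occ_append {B : Type} (u v w : List B) :
    occ u v + occ u w ≤ occ u (v ++ w) ∧
      occ u (v ++ w) ≤ occ u v + occ u w + min (v.length : ℝ) u.length := by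
  induction v with
  | nil => simp [occ]
  | cons a v ih =>
    obtain ⟨h1, h2⟩ := ih
    have hmono : min (v.length : ℝ) u.length ≤ min ((a :: v).length : ℝ) u.length := by
      apply min_le_min_right; simp
    simp only [List.cons_append, occ]
    by_cases hp : u <+: a :: v
    · have hp' : u <+: a :: (v ++ w) := hp.trans ⟨w, by simp⟩
      simp only [hp, hp', if_true]
      exact ⟨by linarith, by linarith⟩
    · by_cases hp' : u <+: a :: (v ++ w)
      · have hl : (a :: v).length < u.length := by
          by_contra hl
          exact hp (List.prefix_of_prefix_length_le hp' ⟨w, by simp⟩ (by omega))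
        have hl' : ((a :: v).length : ℝ) ≤ u.length := by exact_mod_cast hl.le
        rw [min_eq_left hl']
        have : min (v.length : ℝ) u.length ≤ v.length := min_le_left _ _
        simp only [hp, hp', if_true, if_false, List.length_cons, Nat.cast_add, Nat.cast_one]
        exact ⟨by linarith, by linarith⟩
      · simp only [hp, hp', if_false]
        exact ⟨by linarith, by linarith⟩

lemma quasiAdditive_occ {B : Type} (u : List B) {α : ℝ} (h0 : 0 ≤ α) (h1 : α ≤ 1) :
    QuasiAdditive (fun w => occ u w - α * w.length) (u.length + 1) := by
  refine ⟨fun v w => ?_, fun a => ?_⟩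
  · obtain ⟨h2, h3⟩ := occ_append u v w
    have : min (v.length : ℝ) u.length ≤ u.length := min_le_right _ _
    have : (0 : ℝ) ≤ u.length := Nat.cast_nonneg _
    simp only [List.length_append, Nat.cast_add]
    exact abs_le.2 ⟨by linarith, by linarith⟩
  · have : (0 : ℝ) ≤ u.length := Nat.cast_nonneg _
    simp only [occ, List.length_singleton]
    split_ifs <;> exact abs_le.2 ⟨by push_cast; linarith, by push_cast; linarith⟩

/-- The words obtained by gluing `v 0, v 1, …` inside a set with specification. -/
lemma exists_glue {B : Type} {L G : Set (List B)} {τ : ℕ}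
    (h : ∀ v ∈ G, ∀ w ∈ G, ∃ u ∈ L, u.length ≤ τ ∧ v ++ u ++ w ∈ G)
    (v : ℕ → List B) (hv : ∀ i, v i ∈ G) :
    ∃ P r : ℕ → List B, (∀ i, P i ∈ G) ∧ P 0 = v 0 ∧ (∀ i, (r i).length ≤ τ) ∧
      ∀ i, P (i + 1) = P i ++ (r i ++ v (i + 1)) := by
  choose! u _ hu2 hu3 using h
  let P : ℕ → List B := fun n =>
    Nat.rec (v 0) (fun i p => p ++ (u p (v (i + 1)) ++ v (i + 1))) n
  have hP : ∀ i, P i ∈ G := by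
    intro i
    induction i with
    | zero => exact hv 0
    | succ i ih => simpa [P] using hu3 _ ih _ (hv (i + 1))
  exact ⟨P, fun i => u (P i) (v (i + 1)), hP, rfl, fun i => hu2 _ (hP i) _ (hv _), fun i => rfl⟩

lemma QuasiAdditive.abs_glue_sub_sum_le {B : Type} {c : List B → ℝ} {C : ℝ}
    (h : QuasiAdditive c C) {τ : ℕ} {v P r : ℕ → List B} (h0 : P 0 = v 0)
    (hr : ∀ i, (r i).length ≤ τ) (hP : ∀ i, P (i + 1) = P i ++ (r i ++ v (i + 1))) (n : ℕ) :
    |c (P n) - ∑ i ∈ Finset.range (n + 1), c (v i)| ≤ n * (3 * C + 2 * C * τ) := by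
  induction n with
  | zero => simp [h0]
  | succ n ih =>
    have h1 := abs_le.1 (h.append (P n) (r n ++ v (n + 1)))
    have h2 := abs_le.1 (h.append (r n) (v (n + 1)))
    have h3 := abs_le.1 (h.abs_apply_le (r n))
    have h4 := abs_le.1 ih
    have h5 : 2 * C * (r n).length ≤ 2 * C * τ := by
      have := h.const_nonneg
      have : ((r n).length : ℝ) ≤ τ := by exact_mod_cast hr n
      gcongr
    rw [Finset.sum_range_succ, hP n]
    push_cast
    exact abs_le.2 ⟨by linarith, by linarith⟩

lemma sum_length_le_glue {B : Type} {v P r : ℕ → List B} (h0 : P 0 = v 0)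
    (hP : ∀ i, P (i + 1) = P i ++ (r i ++ v (i + 1))) (n : ℕ) :
    ∑ i ∈ Finset.range (n + 1), (v i).length ≤ (P n).length := by
  induction n with
  | zero => simp [h0]
  | succ n ih =>
    rw [Finset.sum_range_succ, hP n]
    simp only [List.length_append]
    omega

lemma length_prefixWord {B : Type} (x : ℕ → B) (n : ℕ) : (prefixWord x n).length = n := by
  simp [prefixWord]

lemma prefixWord_succ {B : Type} (x : ℕ → B) (n : ℕ) :
    prefixWord x (n + 1) = x 0 :: prefixWord (shift x) n := by
  simp [prefixWord, List.ofFn_succ, shift]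

lemma mem_cylinder_iff {B : Type} {u : List B} {x : ℕ → B} :
    x ∈ cylinder u ↔ prefixWord x u.length = u := by
  constructor
  · intro h
    apply List.ext_getElem (by simp [prefixWord])
    intro i h1 h2
    simpa [prefixWord] using h ⟨i, h2⟩
  · intro h i
    have : (prefixWord x u.length)[(i : ℕ)]'(by simp [prefixWord]) = u[(i : ℕ)] := by
      simp only [h]
    simpa [prefixWord] using this

lemma prefixWord_prefix {B : Type} (x : ℕ → B) {m n : ℕ} (h : m ≤ n) :
    prefixWord x m <+: prefixWord x n := by
  rw [List.prefix_iff_eq_take]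
  apply List.ext_getElem (by simp [prefixWord, h])
  intro i h1 h2
  simp [prefixWord]

lemma prefix_prefixWord_iff {B : Type} {u : List B} {x : ℕ → B} {n : ℕ} (h : u.length ≤ n) :
    u <+: prefixWord x n ↔ x ∈ cylinder u := by
  rw [mem_cylinder_iff]
  constructor
  · intro hu
    exact ((List.prefix_of_prefix_length_le (prefixWord_prefix x h) hu
      (by simp [prefixWord])).eq_of_length (by simp [prefixWord]))
  · intro hu
    rw [← hu]
    exact prefixWord_prefix x h

lemma mem_cylinder_of_prefix_prefixWord {B : Type} {u : List B} {x : ℕ → B} {n : ℕ}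
    (h : u <+: prefixWord x n) : x ∈ cylinder u :=
  (prefix_prefixWord_iff (by simpa [prefixWord] using h.length_le)).1 h

/-- The indicator function on `X` of the cylinder of `u`. -/
noncomputable def cylInd {B : Type} (X : Set (ℕ → B)) (u : List B) : ↥X → ℝ :=
  (Subtype.val ⁻¹' cylinder u).indicator 1

lemma cylInd_eq_ite {B : Type} (X : Set (ℕ → B)) (u : List B) (x : ↥X) :
    cylInd X u x = if (x : ℕ → B) ∈ cylinder u then 1 else 0 := by
  simp [cylInd, Set.indicator_apply]

lemma subShift_val {B : Type} {X : Set (ℕ → B)} (hX : MapsTo shift X X) (x : ↥X) :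
    (subShift X x : ℕ → B) = shift x := by
  simp [subShift, hX x.2]

lemma birkhoff_succ {Y : Type*} (σ : Y → Y) (φ : Y → ℝ) (n : ℕ) (y : Y) :
    birkhoff σ φ (n + 1) y = birkhoff σ φ n (σ y) + φ y := by
  simp [birkhoff, Finset.sum_range_succ']

lemma abs_birkhoff_sub_occ_le {B : Type} {X : Set (ℕ → B)} (hX : MapsTo shift X X)
    (u : List B) (n : ℕ) (x : ↥X) :
    |birkhoff (subShift X) (cylInd X u) n x - occ u (prefixWord x n)| ≤ u.length := by
  suffices h : occ u (prefixWord x n) ≤ birkhoff (subShift X) (cylInd X u) n x ∧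
      birkhoff (subShift X) (cylInd X u) n x ≤ occ u (prefixWord x n) + min (n : ℝ) u.length by
    have : min (n : ℝ) u.length ≤ u.length := min_le_right _ _
    exact abs_le.2 ⟨by linarith [h.1, (Nat.cast_nonneg u.length : (0 : ℝ) ≤ u.length)],
      by linarith [h.2]⟩
  induction n generalizing x with
  | zero => simp [prefixWord, occ, birkhoff]
  | succ n ih =>
    obtain ⟨h1, h2⟩ := ih (subShift X x)
    rw [birkhoff_succ, cylInd_eq_ite]
    rw [subShift_val hX] at h1 h2
    have hmono : min (n : ℝ) u.length ≤ min ((n + 1 : ℕ) : ℝ) u.length := by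
      apply min_le_min_right; simp
    rw [prefixWord_succ, occ, ← prefixWord_succ]
    by_cases hp : u <+: prefixWord x (n + 1)
    · simp only [hp, mem_cylinder_of_prefix_prefixWord hp, if_true]
      exact ⟨by linarith, by linarith⟩
    · by_cases hp' : (x : ℕ → B) ∈ cylinder u
      · have hl : n + 1 ≤ u.length := by
          by_contra hl
          exact hp ((prefix_prefixWord_iff (by omega)).2 hp')
        have hl' : ((n + 1 : ℕ) : ℝ) ≤ u.length := by exact_mod_cast hl
        rw [min_eq_left hl']
        have : min (n : ℝ) u.length ≤ n := min_le_left _ _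
        simp only [hp, hp', if_true, if_false]
        push_cast
        exact ⟨by linarith, by linarith⟩
      · simp only [hp, hp', if_false]
        exact ⟨by linarith, by linarith⟩

/-- A finite family of centred integrable functions has almost vanishing averages along some
finite sample. -/
lemma exists_sample {Y ι : Type*} [MeasurableSpace Y] (μ : Measure Y) [IsProbabilityMeasure μ]
    (S : Finset ι) (F : ι → Y → ℝ) (hF : ∀ u, Measurable (F u)) (hi : ∀ u, Integrable (F u) μ)
    (h0 : ∀ u, ∫ y, F u y ∂μ = 0) :
    ∃ K : ℕ, ∃ x : ℕ → Y, ∀ u ∈ S, |∑ i ∈ Finset.range (K + 1), F u (x i)| ≤ K + 1 := by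
  let P : Measure (ℕ → Y) := Measure.infinitePi fun _ => μ
  have hlaw : ∀ u, ∀ᵐ x ∂P, Tendsto (fun n : ℕ => (n : ℝ)⁻¹ • ∑ i ∈ Finset.range n, F u (x i))
      atTop (𝓝 0) := by
    intro u
    have hmp := fun i => measurePreserving_eval_infinitePi (fun _ : ℕ => μ) i
    have h := ProbabilityTheory.strong_law_ae (μ := P) (fun i x => F u (x i))
      ((hmp 0).integrable_comp_of_integrable (hi u))
      (fun i j hij => (ProbabilityTheory.iIndepFun_infinitePi (P := fun _ : ℕ => μ)
        (X := fun _ => F u) (fun _ => hF u)).indepFun hij)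
      (fun i => ⟨((hF u).comp (measurable_pi_apply i)).aemeasurable,
        ((hF u).comp (measurable_pi_apply 0)).aemeasurable, by
          change P.map (F u ∘ Function.eval i) = P.map (F u ∘ Function.eval 0)
          rw [← Measure.map_map (hF u) (measurable_pi_apply i),
            ← Measure.map_map (hF u) (measurable_pi_apply 0), (hmp i).map_eq, (hmp 0).map_eq]⟩)
    have h1 : ∫ x : ℕ → Y, F u (x 0) ∂P = 0 := by
      rw [← h0 u, ← (hmp 0).map_eq, integral_map (measurable_pi_apply 0).aemeasurable
        (hF u).aestronglyMeasurable]
    rwa [h1] at h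
  have hall : ∀ᵐ x ∂P, ∀ u ∈ S, Tendsto (fun n : ℕ => (n : ℝ)⁻¹ • ∑ i ∈ Finset.range n, F u (x i))
      atTop (𝓝 0) := by
    rw [Filter.eventually_all_finset]
    exact fun u _ => hlaw u
  obtain ⟨x, hx⟩ := hall.exists
  have hev : ∀ᶠ n : ℕ in atTop, ∀ u ∈ S,
      |(n : ℝ)⁻¹ • ∑ i ∈ Finset.range n, F u (x i)| ≤ 1 := by
    rw [Filter.eventually_all_finset]
    intro u hu
    have := (hx u hu).abs
    rw [abs_zero] at this
    exact this.eventually_le_const one_pos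
  obtain ⟨n, hn⟩ := ((tendsto_add_atTop_nat 1).eventually hev).exists
  refine ⟨n, x, fun u hu => ?_⟩
  have h := hn u hu
  have hpos : (0 : ℝ) < (n + 1 : ℕ) := by positivity
  rw [smul_eq_mul, abs_mul, abs_inv, abs_of_pos hpos, inv_mul_le_iff₀ hpos, mul_one] at h
  exact_mod_cast h

lemma MistakeFun.eventually_add_mul_le {g : ℕ → ℕ} (hg : MistakeFun g) (a b : ℝ) {ε : ℝ}
    (hε : 0 < ε) : ∀ᶠ N : ℕ in atTop, a + b * g N ≤ ε * N := by
  have h1 : Tendsto (fun N : ℕ => a / N + b * (g N / N)) atTop (𝓝 (0 + b * 0)) :=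
    (tendsto_const_div_atTop_nhds_zero_nat a).add (hg.2.const_mul b)
  rw [mul_zero, add_zero] at h1
  filter_upwards [h1.eventually_le_const hε, eventually_gt_atTop 0] with N hN hN0
  have hpos : (0 : ℝ) < N := by exact_mod_cast hN0
  have : a / N + b * (g N / N) = (a + b * g N) / N := by ring
  rw [this, div_le_iff₀ hpos] at hN
  exact hN

lemma prefixWord_mem_language {B : Type} {X : Set (ℕ → B)} (x : ↥X) (n : ℕ) :
    prefixWord (x : ℕ → B) n ∈ language X :=
  ⟨x, mem_cylinder_iff.2 (by rw [length_prefixWord]), x.2⟩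

lemma measurable_subShift {B : Type} [MeasurableSpace B] {X : Set (ℕ → B)}
    (hX : MapsTo shift X X) : Measurable (subShift X) := by
  have h : subShift X = fun x => ⟨shift (x : ℕ → B), hX x.2⟩ :=
    funext fun x => Subtype.ext (subShift_val hX x)
  rw [h]
  refine Measurable.subtype_mk (measurable_pi_lambda _ fun i => ?_)
  exact (measurable_pi_apply (i + 1)).comp measurable_subtype_coe

lemma integral_birkhoff {Y : Type*} [MeasurableSpace Y] {μ : Measure Y} {σ : Y → Y}
    (hσ : MeasurePreserving σ μ μ) {φ : Y → ℝ} (hφ : Integrable φ μ) (n : ℕ) :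
    Integrable (birkhoff σ φ n) μ ∧ ∫ y, birkhoff σ φ n y ∂μ = n * ∫ y, φ y ∂μ := by
  have hi : ∀ i, Integrable (fun y => φ (σ^[i] y)) μ := fun i =>
    (hσ.iterate i).integrable_comp_of_integrable hφ
  have he : ∀ i, ∫ y, φ (σ^[i] y) ∂μ = ∫ y, φ y ∂μ := by
    intro i
    have h := hσ.iterate i
    conv_rhs => rw [← h.map_eq]
    rw [integral_map h.aemeasurable (by rw [h.map_eq]; exact hφ.aestronglyMeasurable)]
  refine ⟨integrable_finsetSum _ fun i _ => hi i, ?_⟩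
  simp only [birkhoff]
  rw [integral_finsetSum _ fun i _ => hi i]
  simp [he]

section Measure

variable {B : Type} [Finite B] [TopologicalSpace B] [DiscreteTopology B] [MeasurableSpace B]
  [BorelSpace B] {X : Set (ℕ → B)}

lemma measurableSet_val_preimage_cylinder (u : List B) :
    MeasurableSet (Subtype.val ⁻¹' cylinder u : Set ↥X) := by
  have : cylinder u = ⋂ i : Fin u.length, (fun x : ℕ → B => x i) ⁻¹' {u.get i} := by
    ext x; simp [cylinder]
  apply measurable_subtype_coe
  rw [this]
  exact MeasurableSet.iInter fun i => measurable_pi_apply _ (measurableSet_singleton _)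

lemma measurable_cylInd (u : List B) : Measurable (cylInd X u) :=
  measurable_one.indicator (measurableSet_val_preimage_cylinder u)

lemma integrable_cylInd (μ : Measure ↥X) [IsFiniteMeasure μ] (u : List B) :
    Integrable (cylInd X u) μ :=
  (integrable_const (1 : ℝ)).indicator (measurableSet_val_preimage_cylinder u)

lemma integral_cylInd (μ : Measure ↥X) (u : List B) :
    ∫ x, cylInd X u x ∂μ = μ.real (Subtype.val ⁻¹' cylinder u) :=
  integral_indicator_one (measurableSet_val_preimage_cylinder u)

lemma exists_word_near_measure (hX : MapsTo shift X X) {G : Set (List B)}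
    (hspec : HasSpecW (language X) G) (happ : EditApproachable (language X) G)
    (μ : Measure ↥X) [IsProbabilityMeasure μ] (hμ : MeasurePreserving (subShift X) μ μ)
    (S : Finset (List B)) {ε : ℝ} (hε : 0 < ε) (M : ℕ) :
    ∃ V ∈ G, M ≤ V.length ∧ ∀ u ∈ S,
      |occ u V - μ.real (Subtype.val ⁻¹' cylinder u) * V.length| ≤ ε * V.length := by
  obtain ⟨τ, hτ⟩ := hspec
  obtain ⟨g, hg, happ⟩ := happ
  set α : List B → ℝ := fun u => μ.real (Subtype.val ⁻¹' cylinder u) with hα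
  let C : List B → ℝ := fun u => u.length + 1
  have hq : ∀ u, QuasiAdditive (fun w => occ u w - α u * w.length) (C u) := fun u =>
    quasiAdditive_occ u measureReal_nonneg measureReal_le_one
  have hN : ∀ᶠ N : ℕ in atTop, ∀ u ∈ S,
      (u.length + 1 + (3 * C u + 2 * C u * τ)) + (6 * C u + 6 * ε) * g N ≤ ε * N := by
    rw [Filter.eventually_all_finset]
    exact fun u _ => hg.eventually_add_mul_le _ _ hε
  obtain ⟨N, hN, hNM⟩ := (hN.and (hg.eventually_add_mul_le M 6 one_pos)).exists
  obtain ⟨K, x, hx⟩ := exists_sample μ S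
    (fun u y => birkhoff (subShift X) (cylInd X u) N y - N * α u)
    (fun u => by
      have := hμ.measurable
      refine Measurable.sub_const ?_ _
      exact Finset.measurable_fun_sum _ fun i _ => (measurable_cylInd u).comp (this.iterate i))
    (fun u => (integral_birkhoff hμ (integrable_cylInd μ u) N).1.sub (integrable_const _))
    (fun u => by
      have h := integral_birkhoff hμ (integrable_cylInd μ u) N
      rw [integral_sub h.1 (integrable_const _), h.2, integral_cylInd]
      simp [hα])
  choose! v hvG hvd using happ
  let w : ℕ → List B := fun i => prefixWord (x i : ℕ → B) N
  have hw : ∀ i, w i ∈ language X := fun i => prefixWord_mem_language _ _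
  have hwl : ∀ i, (w i).length = N := fun i => length_prefixWord _ _
  have hvd' : ∀ i, (editDist (v (w i)) (w i) : ℝ) ≤ g N := by
    intro i
    have := hvd _ (hw i)
    rw [hwl] at this
    exact_mod_cast this
  obtain ⟨P, r, hPG, hP0, hr, hP⟩ := exists_glue hτ (fun i => v (w i)) fun i => hvG _ (hw i)
  have hlen : ((K + 1 : ℕ) : ℝ) * (N - 6 * g N) ≤ (P K).length := by
    have h1 : (∑ i ∈ Finset.range (K + 1), ((v (w i)).length : ℝ)) ≤ (P K).length := by
      exact_mod_cast sum_length_le_glue (v := fun i => v (w i)) hP0 hP K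
    refine le_trans ?_ h1
    rw [← nsmul_eq_mul]
    conv_lhs => rw [← Finset.card_range (K + 1)]
    refine Finset.card_nsmul_le_sum _ _ _ fun i _ => ?_
    have h2 := abs_le.1 (quasiAdditive_length.abs_sub_le_editDist (v (w i)) (w i))
    rw [hwl] at h2
    linarith [h2.1, hvd' i]
  have hNM' : (M : ℝ) ≤ N - 6 * g N := by linarith
  have hK1 : (1 : ℝ) ≤ (K + 1 : ℕ) := by norm_num
  refine ⟨P K, hPG K, ?_, fun u hu => ?_⟩
  · have : (M : ℝ) ≤ (P K).length := by
      have : (0 : ℝ) ≤ N - 6 * g N := le_trans (Nat.cast_nonneg _) hNM'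
      nlinarith
    exact_mod_cast this
  · have hC : 0 ≤ C u := (hq u).const_nonneg
    have h1 := (hq u).abs_glue_sub_sum_le (v := fun i => v (w i)) hP0 hr hP K
    have h2 : |(∑ i ∈ Finset.range (K + 1), (occ u (v (w i)) - α u * (v (w i)).length)) -
        ∑ i ∈ Finset.range (K + 1), (birkhoff (subShift X) (cylInd X u) N (x i) - N * α u)| ≤
        ((K + 1 : ℕ) : ℝ) * (6 * C u * g N + u.length) := by
      rw [← Finset.sum_sub_distrib]
      refine (Finset.abs_sum_le_sum_abs _ _).trans ((Finset.sum_le_card_nsmul _ _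
        (6 * C u * g N + u.length) fun i _ => ?_).trans_eq (by rw [Finset.card_range, nsmul_eq_mul]))
      have h3 := (hq u).abs_sub_le_editDist (v (w i)) (w i)
      have h4 := abs_birkhoff_sub_occ_le hX u N (x i)
      have h5 : 6 * C u * editDist (v (w i)) (w i) ≤ 6 * C u * g N := by
        exact mul_le_mul_of_nonneg_left (hvd' i) (by positivity)
      rw [hwl] at h3
      have h3' := abs_le.1 (h3.trans h5)
      have h4' := abs_le.1 h4
      exact abs_le.2 ⟨by linarith, by linarith⟩
    have h6 := hx u hu
    have h7 : (K : ℝ) * (3 * C u + 2 * C u * τ) ≤ ((K + 1 : ℕ) : ℝ) * (3 * C u + 2 * C u * τ) := by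
      gcongr; simp
    have h8 : ((K + 1 : ℕ) : ℝ) * ((u.length + 1 + (3 * C u + 2 * C u * τ)) + 6 * C u * g N) ≤
        ε * (P K).length := by
      calc _ ≤ ((K + 1 : ℕ) : ℝ) * (ε * (N - 6 * g N)) := by
            gcongr
            linarith [hN u hu]
        _ = ε * (((K + 1 : ℕ) : ℝ) * (N - 6 * g N)) := by ring
        _ ≤ _ := by gcongr
    have h1' := abs_le.1 h1
    have h2' := abs_le.1 h2
    have h6' := abs_le.1 h6
    push_cast at *
    exact abs_le.2 ⟨by linarith, by linarith⟩

end Measure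

lemma exists_slow (L : ℕ → ℕ) :
    ∃ κ : ℕ → ℕ, Tendsto κ atTop atTop ∧ ∀ᶠ i in atTop, L (κ i) ≤ i := by
  refine ⟨fun i => Nat.findGreatest (fun k => L k ≤ i) i, ?_, ?_⟩
  · refine tendsto_atTop.2 fun k => ?_
    filter_upwards [eventually_ge_atTop (max k (L k))] with i hi
    exact Nat.le_findGreatest (le_of_max_le_left hi) (le_of_max_le_right hi)
  · filter_upwards [eventually_ge_atTop (L 0)] with i hi
    exact Nat.findGreatest_spec (P := fun k => L k ≤ i) (Nat.zero_le i) hi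

lemma exists_mem_forall_prefixWord_eq {B : Type} [TopologicalSpace B] {X : Set (ℕ → B)}
    (hX : IsClosed X) {P : ℕ → List B} (hP : ∀ i, P i <+: P (i + 1))
    (hlen : ∀ i, i < (P i).length) (hL : ∀ i, P i ∈ language X) :
    ∃ z ∈ X, ∀ i, prefixWord z (P i).length = P i := by
  have hmono : ∀ i j, i ≤ j → P i <+: P j := by
    intro i j hij
    induction j, hij using Nat.le_induction with
    | base => exact List.prefix_rfl
    | succ j _ ih => exact ih.trans (hP j)
  have hget : ∀ i n (h : n < (P i).length), (P i)[n] = (P n)[n]'(hlen n) := by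
    intro i n h
    rcases le_total i n with h' | h'
    · exact (hmono i n h').getElem h
    · exact ((hmono n i h').getElem (hlen n)).symm
  choose y hy hyX using hL
  refine ⟨fun n => (P n)[n]'(hlen n), ?_, fun i => ?_⟩
  · refine hX.mem_of_tendsto (f := y) (b := atTop) ?_ (.of_forall hyX)
    refine tendsto_pi_nhds.2 fun n => ?_
    refine tendsto_const_nhds.congr' ?_
    filter_upwards [eventually_ge_atTop n] with i hi
    have hn : n < (P i).length := hi.trans_lt (hlen i)
    have := hy i ⟨n, hn⟩
    simp only [List.get_eq_getElem] at this
    rw [this, hget i n hn]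
  · apply List.ext_getElem (by simp [prefixWord])
    intro n h1 h2
    simp [prefixWord, hget i n h2]

lemma exists_between_lengths {l : ℕ → ℕ} (hl : ∀ i, i < l i) {I n : ℕ} (hn : l I ≤ n) :
    ∃ i, I ≤ i ∧ l i ≤ n ∧ n < l (i + 1) := by
  have hI : I ≤ n := (hl I).le.trans hn
  refine ⟨Nat.findGreatest (fun i => l i ≤ n) n, Nat.le_findGreatest hI hn,
    Nat.findGreatest_spec (P := fun i => l i ≤ n) hI hn, ?_⟩
  by_contra! h
  have := hl (Nat.findGreatest (fun i => l i ≤ n) n + 1)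
  exact absurd h (Nat.findGreatest_is_greatest (P := fun i => l i ≤ n) (Nat.lt_succ_self _)
    (by omega))

/-- If each word of a glued sequence has small `c`-average and is short compared to the preceding
ones, then the limit point has vanishing `c`-averages. -/
lemma QuasiAdditive.eventually_abs_prefixWord_le {B : Type} {c : List B → ℝ} {C : ℝ}
    (h : QuasiAdditive c C) {τ : ℕ} {W P r : ℕ → List B} (h0 : P 0 = W 0)
    (hr : ∀ i, (r i).length ≤ τ) (hP : ∀ i, P (i + 1) = P i ++ (r i ++ W (i + 1)))
    (hW1 : ∀ i, 1 ≤ (W i).length)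
    (hW : Tendsto (fun i => ((W i).length : ℝ)) atTop atTop)
    (hslow : ∀ᶠ i in atTop, (W i).length * (W i).length ≤ i)
    (hc : (fun i => c (W i)) =o[atTop] fun i => ((W i).length : ℝ))
    {z : ℕ → B} (hz : ∀ i, prefixWord z (P i).length = P i) {ε : ℝ} (hε : 0 < ε) :
    ∀ᶠ n : ℕ in atTop, |c (prefixWord z n)| ≤ ε * n := by
  have hC := h.const_nonneg
  set D := 3 * C + 2 * C * τ with hD
  have hsum : ∀ i, (∑ l ∈ Finset.range (i + 1), ((W l).length : ℝ)) ≤ (P i).length := fun i => by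
    exact_mod_cast sum_length_le_glue h0 hP i
  have hsum1 : ∀ i : ℕ, (i : ℝ) ≤ ∑ l ∈ Finset.range i, ((W l).length : ℝ) := by
    intro i
    have := Finset.card_nsmul_le_sum (Finset.range i) (fun l => ((W l).length : ℝ)) 1
      fun l _ => by exact_mod_cast hW1 l
    simpa using this
  have hlen : ∀ i, i < (P i).length := by
    intro i
    have := (hsum1 (i + 1)).trans (hsum i)
    exact_mod_cast this
  have he : (fun i => |c (W i)| + D) =o[atTop] fun i => ((W i).length : ℝ) :=
    hc.norm_left.add (Asymptotics.isLittleO_const_left.2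
      (Or.inr (tendsto_norm_atTop_atTop.comp hW)))
  have hE := he.sum_range (fun i => Nat.cast_nonneg _)
    (tendsto_atTop_mono hsum1 tendsto_natCast_atTop_atTop)
  have hE' := (tendsto_add_atTop_nat 1).eventually (hE.bound (half_pos hε))
  have hS' := (tendsto_add_atTop_nat 1).eventually
    (hslow.and (hW.eventually_ge_atTop ((4 * C + 2 * C * τ) / (ε / 2))))
  obtain ⟨I, hI⟩ := eventually_atTop.1 (hE'.and hS')
  filter_upwards [eventually_ge_atTop (P I).length] with n hn
  obtain ⟨i, hIi, hin, hni⟩ := exists_between_lengths hlen hn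
  obtain ⟨h1, h2, h3⟩ := hI i hIi
  have hPi : |c (P i)| ≤ ε / 2 * (P i).length := by
    have h4 := h.abs_glue_sub_sum_le h0 hr hP i
    have h5 : |∑ l ∈ Finset.range (i + 1), c (W l)| ≤ ∑ l ∈ Finset.range (i + 1), |c (W l)| :=
      Finset.abs_sum_le_sum_abs _ _
    have h6 : ∑ l ∈ Finset.range (i + 1), (|c (W l)| + D) ≤
        ε / 2 * ∑ l ∈ Finset.range (i + 1), ((W l).length : ℝ) := by
      refine (le_abs_self _).trans (h1.trans_eq ?_)
      rw [Real.norm_of_nonneg (Finset.sum_nonneg fun l _ => Nat.cast_nonneg _)]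
    rw [Finset.sum_add_distrib, Finset.sum_const, Finset.card_range, nsmul_eq_mul] at h6
    have h7 : ε / 2 * ∑ l ∈ Finset.range (i + 1), ((W l).length : ℝ) ≤ ε / 2 * (P i).length := by
      gcongr; exact hsum i
    have h8 : 0 ≤ D := by positivity
    push_cast at h6
    have h4' := abs_le.1 h4
    have h5' := abs_le.1 h5
    exact abs_le.2 ⟨by linarith, by linarith⟩
  obtain ⟨s, hs⟩ : P i <+: prefixWord z n := by
    have := prefixWord_prefix z hin
    rwa [hz] at this
  have hsl : (s.length : ℝ) ≤ τ + (W (i + 1)).length := by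
    have h4 : (P i).length + s.length = n := by
      rw [← List.length_append, hs, length_prefixWord]
    have h5 := hr i
    rw [hP i, List.length_append, List.length_append] at hni
    exact_mod_cast (by omega : s.length ≤ τ + (W (i + 1)).length)
  have hsc : C + |c s| ≤ ε / 2 * (P i).length := by
    have h4 := h.abs_apply_le s
    have h5 : 2 * C * s.length ≤ 2 * C * (τ + (W (i + 1)).length) := by gcongr
    have h6 : (1 : ℝ) ≤ (W (i + 1)).length := by exact_mod_cast hW1 _
    rw [div_le_iff₀ (half_pos hε)] at h3
    have h7 : ((W (i + 1)).length : ℝ) * (W (i + 1)).length ≤ (P i).length := by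
      exact_mod_cast h2.trans (hlen i)
    calc C + |c s| ≤ 2 * C * 1 + 2 * C * τ * 1 + 2 * C * (W (i + 1)).length := by linarith
      _ ≤ 2 * C * (W (i + 1)).length + 2 * C * τ * (W (i + 1)).length
          + 2 * C * (W (i + 1)).length := by gcongr
      _ = (4 * C + 2 * C * τ) * (W (i + 1)).length := by ring
      _ ≤ ((W (i + 1)).length * (ε / 2)) * (W (i + 1)).length := by gcongr
      _ = ε / 2 * ((W (i + 1)).length * (W (i + 1)).length) := by ring
      _ ≤ _ := by gcongr
  have h4 := abs_le.1 (h.append (P i) s)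
  rw [hs] at h4
  have h5 := abs_le.1 hPi
  have h6 := neg_abs_le (c s)
  have h7 := le_abs_self (c s)
  have h8 : ε * (P i).length ≤ ε * n := by gcongr
  exact abs_le.2 ⟨by linarith, by linarith⟩

lemma exists_point_of_words {B : Type} [Finite B] [TopologicalSpace B] {X : Set (ℕ → B)}
    (hX : IsClosed X) {G : Set (List B)} (hG : G ⊆ language X) (hspec : HasSpecW (language X) G)
    {α : List B → ℝ} (hα0 : ∀ u, 0 ≤ α u) (hα1 : ∀ u, α u ≤ 1)
    (hV : ∀ (S : Finset (List B)) (ε : ℝ), 0 < ε → ∀ M : ℕ, ∃ V ∈ G, M ≤ V.length ∧ ∀ u ∈ S,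
      |occ u V - α u * V.length| ≤ ε * V.length) :
    ∃ z ∈ X, ∀ (u : List B) (ε : ℝ), 0 < ε →
      ∀ᶠ n : ℕ in atTop, |occ u (prefixWord z n) - α u * n| ≤ ε * n := by
  obtain ⟨τ, hτ⟩ := hspec
  obtain ⟨e, he⟩ := Countable.exists_injective_nat (List B)
  let S : ℕ → Finset (List B) := fun k => ((Set.finite_Iic k).preimage he.injOn).toFinset
  choose V hVG hVl hVc using fun k : ℕ => hV (S k) (1 / ((k : ℝ) + 1)) (by positivity) (k + 1)
  obtain ⟨κ, hκ, hκs⟩ := exists_slow fun k => (V k).length * (V k).length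
  obtain ⟨P, r, hPG, hP0, hr, hP⟩ := exists_glue hτ (fun i => V (κ i)) fun i => hVG _
  have hW1 : ∀ i, 1 ≤ (V (κ i)).length := fun i => le_trans (by omega) (hVl (κ i))
  have hlen : ∀ i, i < (P i).length := by
    intro i
    refine lt_of_lt_of_le ?_ (sum_length_le_glue (v := fun i => V (κ i)) hP0 hP i)
    have := Finset.card_nsmul_le_sum (Finset.range (i + 1)) (fun l => (V (κ l)).length) 1
      fun l _ => hW1 l
    simpa using this
  obtain ⟨z, hzX, hz⟩ := exists_mem_forall_prefixWord_eq hX (fun i => ⟨_, (hP i).symm⟩) hlen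
    fun i => hG (hPG i)
  refine ⟨z, hzX, fun u ε hε => ?_⟩
  have hW : Tendsto (fun i => ((V (κ i)).length : ℝ)) atTop atTop := by
    refine tendsto_natCast_atTop_atTop.comp (tendsto_atTop_mono (fun i => ?_) hκ)
    exact (Nat.le_succ _).trans (hVl (κ i))
  have hc : (fun i => occ u (V (κ i)) - α u * (V (κ i)).length) =o[atTop]
      fun i => ((V (κ i)).length : ℝ) := by
    refine Asymptotics.isLittleO_iff.2 fun δ hδ => ?_
    have h1 : Tendsto (fun i => 1 / ((κ i : ℝ) + 1)) atTop (𝓝 0) :=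
      tendsto_one_div_add_atTop_nhds_zero_nat.comp hκ
    filter_upwards [hκ.eventually_ge_atTop (e u), h1.eventually_le_const hδ] with i hi1 hi2
    have h2 := hVc (κ i) u (by simpa [S] using hi1)
    rw [Real.norm_eq_abs, Real.norm_of_nonneg (Nat.cast_nonneg _)]
    exact h2.trans (by gcongr)
  have := (quasiAdditive_occ u (hα0 u) (hα1 u)).eventually_abs_prefixWord_le
    (W := fun i => V (κ i)) hP0 hr hP hW1 hW hκs hc hz hε
  simpa only [length_prefixWord] using this

lemma exists_forall_prefixWord_eq_imp_dist_lt {B : Type} [Finite B] [TopologicalSpace B]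
    [DiscreteTopology B] {X : Set (ℕ → B)} (hX : IsClosed X) (f : C(↥X, ℝ)) {ε : ℝ}
    (hε : 0 < ε) : ∃ m, ∀ x y : ↥X,
      prefixWord (x : ℕ → B) m = prefixWord (y : ℕ → B) m → |f x - f y| < ε := by
  have : CompactSpace ↥X := isCompact_iff_compactSpace.1 hX.isCompact
  by_contra! hcon
  let t : ℕ → Set (↥X × ↥X) := fun m =>
    {p | (∀ i < m, (p.1 : ℕ → B) i = (p.2 : ℕ → B) i) ∧ ε ≤ |f p.1 - f p.2|}
  have hcl : ∀ m, IsClosed (t m) := by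
    intro m
    have : t m = (⋂ i, ⋂ _ : i < m, {p : ↥X × ↥X | (p.1 : ℕ → B) i = (p.2 : ℕ → B) i}) ∩
        {p | ε ≤ |f p.1 - f p.2|} := by
      ext p; simp [t]
    rw [this]
    refine IsClosed.inter (isClosed_iInter fun i => isClosed_iInter fun _ => ?_) ?_
    · exact isClosed_eq ((continuous_apply i).comp (continuous_subtype_val.comp continuous_fst))
        ((continuous_apply i).comp (continuous_subtype_val.comp continuous_snd))
    · exact isClosed_le (by fun_prop) (by fun_prop)
  obtain ⟨p, hp⟩ := IsCompact.nonempty_iInter_of_sequence_nonempty_isCompact_isClosed t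
    (fun m p hp => ⟨fun i hi => hp.1 i (by omega), hp.2⟩)
    (fun m => by
      obtain ⟨x, y, hxy, h⟩ := hcon m
      refine ⟨(x, y), fun i hi => ?_, h⟩
      exact congrFun (List.ofFn_injective hxy) ⟨i, hi⟩)
    (hcl 0).isCompact hcl
  rw [Set.mem_iInter] at hp
  have heq : p.1 = p.2 := Subtype.ext (funext fun i => (hp (i + 1)).1 i (by omega))
  have := (hp 0).2
  rw [heq, sub_self, abs_zero] at this
  linarith

/-- Convergence of the Birkhoff averages of all cylinder indicators implies genericity. -/
lemma mem_genericPts_of_cylInd {B : Type} [Finite B] [TopologicalSpace B] [DiscreteTopology B]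
    [MeasurableSpace B] [BorelSpace B] {X : Set (ℕ → B)} (hX : IsClosed X)
    (μ : ProbabilityMeasure ↥X) (z : ↥X)
    (h : ∀ u, Tendsto (fun n => birkAvg (subShift X) (cylInd X u) n z) atTop
      (𝓝 (∫ y, cylInd X u y ∂μ.toMeasure))) :
    z ∈ genericPts (subShift X) μ := by
  have := Fintype.ofFinite B
  have hcomp : CompactSpace ↥X := isCompact_iff_compactSpace.1 hX.isCompact
  intro f
  refine Metric.tendsto_atTop'.2 fun ε hε => ?_
  obtain ⟨m, hm⟩ := exists_forall_prefixWord_eq_imp_dist_lt hX f (ε := ε / 3) (by linarith)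
  let b : (Fin m → B) → ℝ := fun w =>
    if h : ∃ y : ↥X, prefixWord (y : ℕ → B) m = List.ofFn w then f h.choose else 0
  let φ : ↥X → ℝ := fun y => ∑ w : Fin m → B, b w * cylInd X (List.ofFn w) y
  have hφ : ∀ y : ↥X, |f y - φ y| ≤ ε / 3 := by
    intro y
    have h1 : φ y = b fun i => (y : ℕ → B) i := by
      have h2 : ∀ w : Fin m → B, b w * cylInd X (List.ofFn w) y =
          if w = (fun i : Fin m => (y : ℕ → B) i) then b w else 0 := by
        intro w
        rw [cylInd_eq_ite, mem_cylinder_iff, List.length_ofFn]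
        have : prefixWord (y : ℕ → B) m = List.ofFn w ↔
            w = (fun i : Fin m => (y : ℕ → B) i) :=
          ⟨fun h => (List.ofFn_injective h).symm, fun h => by rw [h]; rfl⟩
        simp [this]
      simp [φ, h2]
    have h3 : ∃ y' : ↥X, prefixWord (y' : ℕ → B) m = List.ofFn fun i : Fin m => (y : ℕ → B) i :=
      ⟨y, rfl⟩
    rw [h1]
    simp only [b, dif_pos h3]
    exact (hm y _ h3.choose_spec.symm).le
  have hφint : Integrable φ μ.toMeasure :=
    integrable_finsetSum _ fun w _ => (integrable_cylInd μ.toMeasure _).const_mul _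
  have hfint : Integrable f μ.toMeasure := f.continuous.integrable_of_hasCompactSupport
    (HasCompactSupport.of_compactSpace f)
  have hlim : Tendsto (fun n => birkAvg (subShift X) φ n z) atTop
      (𝓝 (∫ y, φ y ∂μ.toMeasure)) := by
    have h1 : ∫ y, φ y ∂μ.toMeasure =
        ∑ w : Fin m → B, b w * ∫ y, cylInd X (List.ofFn w) y ∂μ.toMeasure := by
      rw [integral_finsetSum _ fun w _ => (integrable_cylInd μ.toMeasure _).const_mul _]
      simp [integral_const_mul]
    have h2 : ∀ n, birkAvg (subShift X) φ n z =
        ∑ w : Fin m → B, b w * birkAvg (subShift X) (cylInd X (List.ofFn w)) n z := by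
      intro n
      simp only [birkAvg, birkhoff, φ, Finset.mul_sum]
      rw [Finset.sum_comm]
      exact Finset.sum_congr rfl fun w _ => Finset.sum_congr rfl fun i _ => by ring
    rw [h1]
    simp only [h2]
    exact tendsto_finsetSum _ fun w _ => (h _).const_mul _
  have hint : |∫ y, f y ∂μ.toMeasure - ∫ y, φ y ∂μ.toMeasure| ≤ ε / 3 := by
    rw [← integral_sub hfint hφint]
    have := norm_integral_le_of_norm_le_const (μ := μ.toMeasure) (f := fun y => f y - φ y)
      (.of_forall hφ)
    simpa using this
  have hbirk : ∀ n, |birkAvg (subShift X) (fun y => f y) n z - birkAvg (subShift X) φ n z| ≤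
      ε / 3 := by
    intro n
    rw [birkAvg, birkAvg, ← mul_sub, birkhoff, birkhoff, ← Finset.sum_sub_distrib, abs_mul,
      abs_of_nonneg (by positivity : (0 : ℝ) ≤ (n : ℝ)⁻¹)]
    have h1 : |∑ i ∈ Finset.range n, (f ((subShift X)^[i] z) - φ ((subShift X)^[i] z))| ≤
        n * (ε / 3) := (Finset.abs_sum_le_sum_abs _ _).trans
      ((Finset.sum_le_card_nsmul _ _ (ε / 3) fun i _ => hφ _).trans_eq (by simp))
    rcases Nat.eq_zero_or_pos n with rfl | hn
    · simp; linarith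
    · rw [inv_mul_le_iff₀ (by exact_mod_cast hn)]
      exact h1
  obtain ⟨N, hN⟩ := Metric.tendsto_atTop'.1 hlim (ε / 3) (by linarith)
  refine ⟨N, fun n hn => ?_⟩
  have h1 := hN n hn
  rw [Real.dist_eq] at h1 ⊢
  have h1' := abs_lt.1 h1
  have h2' := abs_le.1 (hbirk n)
  have h3' := abs_le.1 hint
  exact abs_lt.2 ⟨by linarith, by linarith⟩

/-- every invariant measure has a generic point. -/
theorem statement_10 {A : Type} [Fintype A] [DecidableEq A] [TopologicalSpace A]
    [DiscreteTopology A] [MeasurableSpace A] [BorelSpace A]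
    (X : Set (ℕ → A)) (hXcl : IsClosed X) (hXinv : Set.MapsTo shift X X)
    (G : Set (List A)) (hG : G ⊆ language X)
    (hspec : HasSpecW (language X) G) (happ : EditApproachable (language X) G)
    (μ : ProbabilityMeasure ↥X) (hμ : IsInvariant (subShift X) μ) :
    (genericPts (subShift X) μ).Nonempty := by
  have hmp : MeasurePreserving (subShift X) μ.toMeasure μ.toMeasure :=
    ⟨measurable_subShift hXinv, hμ⟩
  obtain ⟨z, hzX, hz⟩ := exists_point_of_words hXcl hG hspec
    (α := fun u => μ.toMeasure.real (Subtype.val ⁻¹' cylinder u))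
    (fun _ => measureReal_nonneg) (fun _ => measureReal_le_one)
    fun S _ hε M => exists_word_near_measure hXinv hspec happ μ.toMeasure hmp S hε M
  refine ⟨⟨z, hzX⟩, mem_genericPts_of_cylInd hXcl μ _ fun u => ?_⟩
  rw [integral_cylInd]
  refine Metric.tendsto_nhds.2 fun ε hε => ?_
  have hu := (tendsto_const_div_atTop_nhds_zero_nat (u.length : ℝ)).eventually_lt_const
    (half_pos hε)
  filter_upwards [hz u (ε / 2) (half_pos hε), hu, eventually_gt_atTop 0] with n h1 h2 h3
  have hn : (0 : ℝ) < n := by exact_mod_cast h3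
  rw [div_lt_iff₀ hn] at h2
  have h4 := abs_le.1 (abs_birkhoff_sub_occ_le hXinv u n ⟨z, hzX⟩)
  have h5 := abs_le.1 h1
  rw [Real.dist_eq, birkAvg, inv_mul_eq_div, div_sub' hn.ne', abs_div, abs_of_pos hn,
    div_lt_iff₀ hn]
  exact abs_lt.2 ⟨by linarith, by linarith⟩

end Paper
end
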